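/- Let Λ be a finite dimensional algebra over an algebraically closed field k. (a) A subset {T_i | i ∈ I} of ftors Λ has a meet in the poset ftors Λ if and only if ∩_{i∈I} T_i is functorially finite. (b) A subset {T_i | i ∈ I} of ftors Λ has a join in ftors Λ if and only if ^⊥(∩_{i∈I} T_i^⊥) is functorially finite. -/

import Mathlib

noncomputable section

namespace TorsionLattice


/-! ### Posets: meets and joins (as unique maximal/minimal bounds), semilattices -/

section Posets

variable {P : Type*} [PartialOrder P]

/-- `m` is a maximal element of the subset `S`. -/
def MaximalIn (S : Set P) (m : P) : Prop := m ∈ S ∧ ∀ y ∈ S, m ≤ y → y = m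

/-- `m` is a minimal element of the subset `S`. -/
def MinimalIn (S : Set P) (m : P) : Prop := m ∈ S ∧ ∀ y ∈ S, y ≤ m → y = m

/-- `m` is a meet of `S` : the unique maximal element of the set of lower bounds of `S`. -/
def IsMeetOf (S : Set P) (m : P) : Prop :=
  MaximalIn (lowerBounds S) m ∧ ∀ y, MaximalIn (lowerBounds S) y → y = m

/-- `m` is a join of `S` : the unique minimal element of the set of upper bounds of `S`. -/
def IsJoinOf (S : Set P) (m : P) : Prop :=
  MinimalIn (upperBounds S) m ∧ ∀ y, MinimalIn (upperBounds S) y → y = m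

def HasMeet (S : Set P) : Prop := ∃ m, IsMeetOf S m

def HasJoin (S : Set P) : Prop := ∃ m, IsJoinOf S m

end Posets

/-- Every finite subset has a meet. -/
def IsMeetSemilatticePoset (P : Type*) [PartialOrder P] : Prop :=
  ∀ S : Set P, S.Finite → HasMeet S

/-- Every finite subset has a join. -/
def IsJoinSemilatticePoset (P : Type*) [PartialOrder P] : Prop :=
  ∀ S : Set P, S.Finite → HasJoin S

def IsLatticePoset (P : Type*) [PartialOrder P] : Prop :=
  IsJoinSemilatticePoset P ∧ IsMeetSemilatticePoset P

def IsCompleteMeetSemilatticePoset (P : Type*) [PartialOrder P] : Prop :=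
  ∀ S : Set P, HasMeet S

def IsCompleteJoinSemilatticePoset (P : Type*) [PartialOrder P] : Prop :=
  ∀ S : Set P, HasJoin S

def IsCompleteLatticePoset (P : Type*) [PartialOrder P] : Prop :=
  ∀ S : Set P, HasMeet S ∧ HasJoin S

def PreservesMeets {P Q : Type*} [PartialOrder P] [PartialOrder Q] (f : P → Q) : Prop :=
  ∀ (S : Set P) (m : P), IsMeetOf S m → IsMeetOf (f '' S) (f m)

def PreservesJoins {P Q : Type*} [PartialOrder P] [PartialOrder Q] (f : P → Q) : Prop :=
  ∀ (S : Set P) (m : P), IsJoinOf S m → IsJoinOf (f '' S) (f m)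

/-! ### Torsion classes in `mod Λ`

We model the category `mod Λ` of finite dimensional (equivalently, finitely generated)
`Λ`-modules by the objects of `ModuleCat.{0} Λ` satisfying `Module.Finite Λ`.
Subcategories closed under isomorphisms are modelled as sets of objects. -/

section Torsion

variable (Λ : Type) [Ring Λ]

/-- `0 → X → Y → Z → 0` is a short exact sequence. -/
def IsSES {X Y Z : Type} [AddCommGroup X] [Module Λ X] [AddCommGroup Y] [Module Λ Y]
    [AddCommGroup Z] [Module Λ Z] (f : X →ₗ[Λ] Y) (g : Y →ₗ[Λ] Z) : Prop :=
  Function.Injective f ∧ Function.Surjective g ∧ LinearMap.range f = LinearMap.ker g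

/-- All members of `C` are finite (equivalently, finite dimensional) modules,
i.e. `C` is a subcategory of `mod Λ`. -/
def FinMods (C : Set (ModuleCat.{0} Λ)) : Prop := ∀ X ∈ C, Module.Finite Λ X

/-- `C` is closed under factor modules (in particular under isomorphisms). -/
def QuotClosed (C : Set (ModuleCat.{0} Λ)) : Prop :=
  ∀ X ∈ C, ∀ (Y : ModuleCat.{0} Λ) (f : ↥X →ₗ[Λ] ↥Y), Function.Surjective f → Y ∈ C

/-- `C` is closed under submodules (in particular under isomorphisms). -/
def SubClosed (C : Set (ModuleCat.{0} Λ)) : Prop :=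
  ∀ X ∈ C, ∀ (Y : ModuleCat.{0} Λ) (f : ↥Y →ₗ[Λ] ↥X), Function.Injective f → Y ∈ C

/-- `C` is closed under extensions. -/
def ExtClosed (C : Set (ModuleCat.{0} Λ)) : Prop :=
  ∀ (X Y Z : ModuleCat.{0} Λ) (f : ↥X →ₗ[Λ] ↥Y) (g : ↥Y →ₗ[Λ] ↥Z),
    IsSES Λ f g → X ∈ C → Z ∈ C → Y ∈ C

/-- A torsion class in `mod Λ`: a class of finite dimensional modules closed under
factor modules, isomorphisms and extensions. -/
def IsTorsionClass (C : Set (ModuleCat.{0} Λ)) : Prop :=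
  FinMods Λ C ∧ QuotClosed Λ C ∧ ExtClosed Λ C

/-- A torsionfree class in `mod Λ`: a class of finite dimensional modules closed under
submodules, isomorphisms and extensions. -/
def IsTorsionFreeClass (C : Set (ModuleCat.{0} Λ)) : Prop :=
  FinMods Λ C ∧ SubClosed Λ C ∧ ExtClosed Λ C

/-- `Fac X`: factor modules of finite direct sums of copies of `X`. -/
def Fac (X : ModuleCat.{0} Λ) : Set (ModuleCat.{0} Λ) :=
  {Y | ∃ (n : ℕ) (f : (Fin n → ↥X) →ₗ[Λ] ↥Y), Function.Surjective f}

/-- `C` is of the form `Fac X` for a finite dimensional module `X`; for a torsion class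
this means precisely that `C` is functorially finite in `mod Λ`. -/
def IsFacFinite (C : Set (ModuleCat.{0} Λ)) : Prop :=
  ∃ X : ModuleCat.{0} Λ, Module.Finite Λ X ∧ C = Fac Λ X

/-- A functorially finite torsion class in `mod Λ`. -/
def IsFTorsionClass (C : Set (ModuleCat.{0} Λ)) : Prop :=
  IsTorsionClass Λ C ∧ IsFacFinite Λ C

/-- The poset `tors Λ` of torsion classes, ordered by inclusion. -/
abbrev Tors := {C : Set (ModuleCat.{0} Λ) // IsTorsionClass Λ C}

/-- The poset `torf Λ` of torsionfree classes, ordered by inclusion. -/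
abbrev Torf := {C : Set (ModuleCat.{0} Λ) // IsTorsionFreeClass Λ C}

/-- The poset `ftors Λ` of functorially finite torsion classes, ordered by inclusion. -/
abbrev FTors := {C : Set (ModuleCat.{0} Λ) // IsFTorsionClass Λ C}

/-- `C^⊥ = {X ∈ mod Λ ∣ Hom(C, X) = 0}`. -/
def rperp (C : Set (ModuleCat.{0} Λ)) : Set (ModuleCat.{0} Λ) :=
  {X | Module.Finite Λ X ∧ ∀ T ∈ C, ∀ f : ↥T →ₗ[Λ] ↥X, f = 0}

/-- `^⊥C = {X ∈ mod Λ ∣ Hom(X, C) = 0}`. -/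
def lperp (C : Set (ModuleCat.{0} Λ)) : Set (ModuleCat.{0} Λ) :=
  {X | Module.Finite Λ X ∧ ∀ T ∈ C, ∀ f : ↥X →ₗ[Λ] ↥T, f = 0}

/-- The intersection, inside `mod Λ`, of a family of subcategories of `mod Λ`. -/
def interMod (𝒮 : Set (Set (ModuleCat.{0} Λ))) : Set (ModuleCat.{0} Λ) :=
  {X | Module.Finite Λ X ∧ ∀ C ∈ 𝒮, X ∈ C}

/-- `Hom_Λ(X, Y) = 0`. -/
def HomZero (X Y : ModuleCat.{0} Λ) : Prop := ∀ f : ↥X →ₗ[Λ] ↥Y, f = 0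

/-- `X` is an indecomposable module: it is nonzero and its endomorphism ring has no
nontrivial idempotents. -/
def Indecomp (X : ModuleCat.{0} Λ) : Prop :=
  Nontrivial ↥X ∧ ∀ e : ↥X →ₗ[Λ] ↥X, e ∘ₗ e = e → e = 0 ∨ e = LinearMap.id

/-- `Ext¹_Λ(X, Y) ≠ 0` : there is a non-split short exact sequence `0 → Y → E → X → 0`. -/
def Ext1Nonzero (X Y : ModuleCat.{0} Λ) : Prop :=
  ∃ (E : ModuleCat.{0} Λ) (f : ↥Y →ₗ[Λ] ↥E) (g : ↥E →ₗ[Λ] ↥X),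
    IsSES Λ f g ∧ ¬∃ s : ↥X →ₗ[Λ] ↥E, g ∘ₗ s = LinearMap.id

/-- `X` is rigid : `Ext¹_Λ(X, X) = 0`. -/
def IsRigid (X : ModuleCat.{0} Λ) : Prop := ¬ Ext1Nonzero Λ X X

end Torsion


section TorsionBasics

variable {Λ : Type} [Ring Λ] {T : Set (ModuleCat.{0} Λ)}
variable {X Y : Type} [AddCommGroup X] [Module Λ X] [AddCommGroup Y] [Module Λ Y]

/-- A nonempty torsion class. -/
structure IsNonemptyTorsion (T : Set (ModuleCat.{0} Λ)) : Prop where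
  isTorsionClass : IsTorsionClass Λ T
  nonempty : T.Nonempty

namespace IsNonemptyTorsion

theorem finite (hT : IsNonemptyTorsion T) (hX : ModuleCat.of Λ X ∈ T) : Module.Finite Λ X :=
  hT.isTorsionClass.1 _ hX

theorem quot (hT : IsNonemptyTorsion T) (hX : ModuleCat.of Λ X ∈ T) (f : X →ₗ[Λ] Y)
    (hf : Function.Surjective f) : ModuleCat.of Λ Y ∈ T :=
  hT.isTorsionClass.2.1 _ hX (ModuleCat.of Λ Y) f hf

theorem of_subsingleton (hT : IsNonemptyTorsion T) [Subsingleton X] : ModuleCat.of Λ X ∈ T := by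
  obtain ⟨Z, hZ⟩ := hT.nonempty
  exact hT.isTorsionClass.2.1 _ hZ (ModuleCat.of Λ X) (0 : ↥Z →ₗ[Λ] X)
    fun x => ⟨0, Subsingleton.elim (α := X) _ _⟩

theorem ext_ker (hT : IsNonemptyTorsion T) (g : X →ₗ[Λ] Y) (hg : Function.Surjective g)
    (hK : ModuleCat.of Λ (LinearMap.ker g) ∈ T) (hY : ModuleCat.of Λ Y ∈ T) :
    ModuleCat.of Λ X ∈ T :=
  hT.isTorsionClass.2.2 (ModuleCat.of Λ (LinearMap.ker g)) (ModuleCat.of Λ X)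
    (ModuleCat.of Λ Y) (LinearMap.ker g).subtype g
    ⟨Subtype.val_injective, hg, Submodule.range_subtype _⟩ hK hY

theorem ext (hT : IsNonemptyTorsion T) (N : Submodule Λ X) (hN : ModuleCat.of Λ N ∈ T)
    (hQ : ModuleCat.of Λ (X ⧸ N) ∈ T) : ModuleCat.of Λ X ∈ T := by
  refine hT.ext_ker N.mkQ N.mkQ_surjective ?_ hQ
  rwa [Submodule.ker_mkQ]

theorem range (hT : IsNonemptyTorsion T) (hX : ModuleCat.of Λ X ∈ T) (f : X →ₗ[Λ] Y) :
    ModuleCat.of Λ (LinearMap.range f) ∈ T :=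
  hT.quot hX f.rangeRestrict f.surjective_rangeRestrict

theorem prod (hT : IsNonemptyTorsion T) (hX : ModuleCat.of Λ X ∈ T)
    (hY : ModuleCat.of Λ Y ∈ T) : ModuleCat.of Λ (X × Y) ∈ T := by
  refine hT.ext_ker (LinearMap.snd Λ X Y) LinearMap.snd_surjective ?_ hY
  refine hT.quot hX ((LinearMap.inl Λ X Y).codRestrict _ fun x => by simp) ?_
  rintro ⟨⟨x, y⟩, h⟩
  obtain rfl : y = 0 := h
  exact ⟨x, rfl⟩

theorem pi (hT : IsNonemptyTorsion T) (hX : ModuleCat.of Λ X ∈ T) (n : ℕ) :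
    ModuleCat.of Λ (Fin n → X) ∈ T := by
  induction n with
  | zero => exact hT.of_subsingleton
  | succ n ih =>
    exact hT.quot (hT.prod hX ih) (Fin.consLinearEquiv Λ (fun _ => X)).toLinearMap
      (Fin.consLinearEquiv Λ (fun _ => X)).surjective

theorem fac_subset (hT : IsNonemptyTorsion T) {Z : ModuleCat.{0} Λ} (hZ : Z ∈ T) :
    Fac Λ Z ⊆ T := by
  rintro W ⟨n, f, hf⟩
  exact hT.quot (hT.pi hZ n) f hf

theorem sup (hT : IsNonemptyTorsion T) (N N' : Submodule Λ X) (h : ModuleCat.of Λ N ∈ T)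
    (h' : ModuleCat.of Λ N' ∈ T) : ModuleCat.of Λ ↥(N ⊔ N') ∈ T := by
  have := hT.range (hT.prod h h') (N.subtype.coprod N'.subtype)
  rwa [LinearMap.range_coprod, Submodule.range_subtype, Submodule.range_subtype] at this

/-- Every noetherian module has a largest submodule in a given torsion class. -/
theorem exists_torsion (hT : IsNonemptyTorsion T) (X : Type) [AddCommGroup X] [Module Λ X]
    [hN : IsNoetherian Λ X] :
    ∃ t : Submodule Λ X, ModuleCat.of Λ t ∈ T ∧ ∀ (Y : Type) [AddCommGroup Y] [Module Λ Y],
      ModuleCat.of Λ Y ∈ T → ∀ f : Y →ₗ[Λ] X, LinearMap.range f ≤ t := by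
  obtain ⟨t, ht, hmax⟩ := set_has_maximal_iff_noetherian.mpr hN
    {t : Submodule Λ X | ModuleCat.of Λ t ∈ T}
    ⟨⊥, hT.of_subsingleton (X := (⊥ : Submodule Λ X))⟩
  refine ⟨t, ht, fun Y _ _ hY f => ?_⟩
  have h := hT.sup t _ ht (hT.range hY f)
  by_contra hle
  exact hmax _ h (left_lt_sup.mpr hle)

theorem exists_torsion_quotient (hT : IsNonemptyTorsion T) (X : Type) [AddCommGroup X]
    [Module Λ X] [IsNoetherian Λ X] :
    ∃ t : Submodule Λ X, ModuleCat.of Λ t ∈ T ∧ ∀ (Y : Type) [AddCommGroup Y] [Module Λ Y],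
      ModuleCat.of Λ Y ∈ T → ∀ f : Y →ₗ[Λ] X ⧸ t, f = 0 := by
  obtain ⟨t, ht, hmax⟩ := hT.exists_torsion X
  refine ⟨t, ht, fun Y _ _ hY f => ?_⟩
  have hR := hT.range hY f
  set R := LinearMap.range f
  let N := R.comap t.mkQ
  let g : N →ₗ[Λ] R := t.mkQ.restrict fun _ hx => hx
  have hg : Function.Surjective g := by
    rintro ⟨r, hr⟩
    obtain ⟨x, rfl⟩ := t.mkQ_surjective r
    exact ⟨⟨x, hr⟩, rfl⟩
  have htN : t ≤ N := fun x hx => by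
    change t.mkQ x ∈ R
    rw [(Submodule.Quotient.mk_eq_zero t).mpr hx |> (show t.mkQ x = 0 from ·)]
    exact R.zero_mem
  have hK : ModuleCat.of Λ (LinearMap.ker g) ∈ T := by
    refine hT.quot ht ((Submodule.inclusion htN).codRestrict _ fun x => ?_) ?_
    · apply Subtype.ext
      exact (Submodule.Quotient.mk_eq_zero t).mpr x.2
    · rintro ⟨⟨x, hx⟩, h⟩
      have : t.mkQ x = 0 := congrArg Subtype.val h
      exact ⟨⟨x, (Submodule.Quotient.mk_eq_zero t).mp this⟩, rfl⟩
  have hle := hmax N (hT.ext_ker g hg hK hR) N.subtype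
  rw [Submodule.range_subtype] at hle
  ext y
  obtain ⟨x, hx⟩ := t.mkQ_surjective (f y)
  have hxN : x ∈ N := by
    change t.mkQ x ∈ R
    rw [hx]
    exact ⟨y, rfl⟩
  rw [← hx]
  exact (Submodule.Quotient.mk_eq_zero t).mpr (hle hxN)

/-- A noetherian module generated by images of modules in a torsion class lies in it. -/
theorem mem_of_trace (hT : IsNonemptyTorsion T) [IsNoetherian Λ X] (hY : ModuleCat.of Λ Y ∈ T)
    {s : Set (Y →ₗ[Λ] X)} (h : ⨆ f ∈ s, LinearMap.range f = ⊤) : ModuleCat.of Λ X ∈ T := by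
  obtain ⟨t, ht, hmax⟩ := hT.exists_torsion X
  have : t = ⊤ := top_le_iff.mp (h ▸ iSup₂_le fun f _ => hmax Y hY f)
  subst this
  exact hT.quot ht (⊤ : Submodule Λ X).subtype fun x => ⟨⟨x, trivial⟩, rfl⟩

theorem mem_trace (hT : IsNonemptyTorsion T) [IsNoetherian Λ X] (hY : ModuleCat.of Λ Y ∈ T)
    (s : Set (Y →ₗ[Λ] X)) : ModuleCat.of Λ ↥(⨆ f ∈ s, LinearMap.range f) ∈ T := by
  set N := ⨆ f ∈ s, LinearMap.range f
  have hle : ∀ f ∈ s, LinearMap.range f ≤ N := fun f hf => le_iSup₂_of_le f hf le_rfl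
  refine hT.mem_of_trace hY (s := {g | N.subtype ∘ₗ g ∈ s}) ?_
  refine top_le_iff.mp ?_
  have key : N ≤ (⨆ g ∈ {g : Y →ₗ[Λ] N | N.subtype ∘ₗ g ∈ s}, LinearMap.range g).map
      N.subtype := by
    refine iSup₂_le fun f hf => ?_
    rintro _ ⟨y, rfl⟩
    let g : Y →ₗ[Λ] N := f.codRestrict N fun y => hle f hf ⟨y, rfl⟩
    have hgs : g ∈ {g : Y →ₗ[Λ] N | N.subtype ∘ₗ g ∈ s} := by
      change N.subtype ∘ₗ g ∈ s
      rwa [LinearMap.subtype_comp_codRestrict]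
    exact ⟨g y, (le_iSup₂_of_le (f := fun g _ => LinearMap.range g) g hgs le_rfl) ⟨y, rfl⟩, rfl⟩
  rintro ⟨x, hx⟩ -
  obtain ⟨y, hy, hxy⟩ := key hx
  obtain rfl : y = ⟨x, hx⟩ := Subtype.ext hxy
  exact hy

theorem mem_of_lperp_rperp (hT : IsNonemptyTorsion T) [IsNoetherian Λ X]
    (h : ModuleCat.of Λ X ∈ lperp Λ (rperp Λ T)) : ModuleCat.of Λ X ∈ T := by
  obtain ⟨t, ht, hzero⟩ := hT.exists_torsion_quotient X
  have hmk : t.mkQ = 0 := h.2 (ModuleCat.of Λ (X ⧸ t))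
    ⟨inferInstanceAs (Module.Finite Λ (X ⧸ t)), fun Z hZ f => hzero Z hZ f⟩ t.mkQ
  have : t = ⊤ := by rw [← t.ker_mkQ, hmk, LinearMap.ker_zero]
  subst this
  exact hT.quot ht (⊤ : Submodule Λ X).subtype fun x => ⟨⟨x, trivial⟩, rfl⟩

end IsNonemptyTorsion

theorem self_mem_fac (Z : ModuleCat.{0} Λ) : Z ∈ Fac Λ Z :=
  ⟨1, LinearMap.proj 0, fun x => ⟨fun _ => x, rfl⟩⟩

theorem IsFTorsionClass.isNonemptyTorsion (h : IsFTorsionClass Λ T) : IsNonemptyTorsion T := by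
  obtain ⟨Z, -, rfl⟩ := h.2
  exact ⟨h.1, Z, self_mem_fac Z⟩

/-- The modules generated by `Y` are the factor modules of finite powers of `Y`. -/
theorem mem_fac_of_trace [Module.Finite Λ X] {s : Set (Y →ₗ[Λ] X)}
    (h : ⨆ f ∈ s, LinearMap.range f = ⊤) :
    ModuleCat.of Λ X ∈ Fac Λ (ModuleCat.of Λ Y) := by
  have hc : IsCompactElement (⊤ : Submodule Λ X) :=
    (Submodule.fg_iff_compact _).mp Module.Finite.fg_top
  obtain ⟨t, ht⟩ := CompleteLattice.IsCompactElement.exists_finset_of_le_iSup _ hc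
    (fun f : s => LinearMap.range f.1) (by rw [iSup_subtype'] at h; exact h.ge)
  let e := t.equivFin
  refine ⟨t.card, LinearMap.lsum Λ (fun _ => Y) ℕ fun i => (e.symm i).1.1, ?_⟩
  refine LinearMap.range_eq_top.mp (top_le_iff.mp (ht.trans (iSup₂_le fun f hf => ?_)))
  rintro _ ⟨y, rfl⟩
  refine ⟨Pi.single (e ⟨f, hf⟩) y, ?_⟩
  change LinearMap.lsum Λ (fun _ => Y) ℕ (fun i => (e.symm i).1.1) (Pi.single (e ⟨f, hf⟩) y) = f.1 y
  rw [LinearMap.lsum_piSingle]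
  simp

end TorsionBasics

section Approximation

variable {Λ : Type} [Ring Λ] {T : Set (ModuleCat.{0} Λ)}

/-- An element `p` of `P` such that `Λ → P`, `1 ↦ p` is a minimal left approximation of the
regular module by the class `T`. -/
structure IsMinimalApprox (T : Set (ModuleCat.{0} Λ)) {P : Type} [AddCommGroup P] [Module Λ P]
    (p : P) : Prop where
  mem : ModuleCat.of Λ P ∈ T
  exists_map : ∀ (Y : Type) [AddCommGroup Y] [Module Λ Y], ModuleCat.of Λ Y ∈ T → ∀ y : Y,
    ∃ f : P →ₗ[Λ] Y, f p = y
  bijective : ∀ f : P →ₗ[Λ] P, f p = p → Function.Bijective f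

theorem IsNonemptyTorsion.exists_approx (k : Type) [Field k] [Algebra k Λ]
    [FiniteDimensional k Λ] (hT : IsNonemptyTorsion T) (hfac : IsFacFinite Λ T) :
    ∃ (X : ModuleCat.{0} Λ) (x : X), X ∈ T ∧ ∀ (Y : Type) [AddCommGroup Y] [Module Λ Y],
      ModuleCat.of Λ Y ∈ T → ∀ y : Y, ∃ f : X →ₗ[Λ] Y, f x = y := by
  obtain ⟨X, hX, rfl⟩ := hfac
  let _ : Module k X := Module.compHom X (algebraMap k Λ)
  have : IsScalarTower k Λ X := ⟨fun a b x => by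
    rw [Algebra.smul_def, mul_smul]
    rfl⟩
  have : Module.Finite k X := Module.Finite.trans Λ X
  obtain ⟨n, x, hx⟩ := Module.Finite.exists_fin (R := k) (M := X)
  refine ⟨ModuleCat.of Λ (Fin n → X), x, hT.pi (self_mem_fac X) n, ?_⟩
  rintro Y _ _ ⟨m, g, hg⟩ y
  obtain ⟨z, rfl⟩ := hg y
  change Fin m → X at z
  have hz : ∀ j, ∃ c : Fin n → k, ∑ i, c i • x i = z j := fun j =>
    (Submodule.mem_span_range_iff_exists_fun k).mp (hx ▸ Submodule.mem_top)
  choose c hc using hz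
  refine ⟨(g : (Fin m → X) →ₗ[Λ] Y) ∘ₗ
    LinearMap.pi fun j => ∑ i, c j i • LinearMap.proj (R := Λ) (φ := fun _ : Fin n => ↥X) i, ?_⟩
  refine congrArg (g : (Fin m → X) →ₗ[Λ] Y) (funext fun j => ?_)
  simp [hc]

theorem IsNonemptyTorsion.exists_isMinimalApprox (k : Type) [Field k] [Algebra k Λ]
    [FiniteDimensional k Λ] [IsArtinianRing Λ] (hT : IsNonemptyTorsion T)
    (hfac : IsFacFinite Λ T) :
    ∃ (P : ModuleCat.{0} Λ) (p : P), IsMinimalApprox T p := by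
  obtain ⟨X, x, hX, happ⟩ := hT.exists_approx k hfac
  have : Module.Finite Λ X := hT.finite (X := X) hX
  obtain ⟨S, ⟨hS, hxS, hSapp⟩, hmin⟩ := IsArtinian.set_has_minimal
    {S : Submodule Λ X | ModuleCat.of Λ S ∈ T ∧ ∃ h : x ∈ S,
      ∀ (Y : Type) [AddCommGroup Y] [Module Λ Y], ModuleCat.of Λ Y ∈ T → ∀ y : Y,
        ∃ f : S →ₗ[Λ] Y, f ⟨x, h⟩ = y}
    ⟨⊤, hT.quot hX (Submodule.topEquiv (R := Λ) (M := X)).symm.toLinearMap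
      (Submodule.topEquiv (R := Λ) (M := X)).symm.surjective, trivial, fun Y _ _ hY y => by
        obtain ⟨f, hf⟩ := happ Y hY y
        exact ⟨f ∘ₗ Submodule.subtype _, hf⟩⟩
  refine ⟨ModuleCat.of Λ S, (⟨x, hxS⟩ : S), hS, fun Y _ _ hY y => hSapp Y hY y, ?_⟩
  intro (f : S →ₗ[Λ] S) (hf : f ⟨x, hxS⟩ = ⟨x, hxS⟩)
  have hsurj : Function.Surjective f := by
    let R := LinearMap.range (S.subtype ∘ₗ f)
    have hxR : x ∈ R := ⟨⟨x, hxS⟩, by simp [hf]⟩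
    have hRS : R ≤ S := by
      rintro _ ⟨y, rfl⟩
      exact (f y).2
    have hR : R = S := by
      refine eq_of_le_of_not_lt hRS (hmin R ⟨hT.range hS _, hxR, fun Y _ _ hY y => ?_⟩)
      obtain ⟨g, hg⟩ := hSapp Y hY y
      exact ⟨g ∘ₗ Submodule.inclusion hRS, hg⟩
    intro y
    obtain ⟨z, hz⟩ : (y : X) ∈ R := hR.symm ▸ y.2
    exact ⟨z, Subtype.ext hz⟩
  exact ⟨IsNoetherian.injective_of_surjective_endomorphism f hsurj, hsurj⟩

/-- `Ext¹(P, T) = 0`, phrased as a lifting property. -/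
def IsExtProjective (T : Set (ModuleCat.{0} Λ)) (P : Type) [AddCommGroup P] [Module Λ P] : Prop :=
  ∀ (Y Z : Type) [AddCommGroup Y] [Module Λ Y] [AddCommGroup Z] [Module Λ Z] (g : Y →ₗ[Λ] Z),
    Function.Surjective g → ModuleCat.of Λ (LinearMap.ker g) ∈ T → ∀ h : P →ₗ[Λ] Z,
      ∃ h' : P →ₗ[Λ] Y, g ∘ₗ h' = h

section

variable {P : Type} [AddCommGroup P] [Module Λ P] {p : P}

theorem IsMinimalApprox.isExtProjective (hT : IsNonemptyTorsion T) (hp : IsMinimalApprox T p) :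
    IsExtProjective T P := by
  intro Y Z _ _ _ _ g hg hK h
  let E := LinearMap.ker (h ∘ₗ LinearMap.fst Λ P Y - g ∘ₗ LinearMap.snd Λ P Y)
  have hE : ∀ {a : P} {y : Y}, (a, y) ∈ E ↔ h a = g y := by
    intro a y
    simp [E, sub_eq_zero]
  let π : E →ₗ[Λ] P := LinearMap.fst Λ P Y ∘ₗ E.subtype
  have hπ : Function.Surjective π := fun a => by
    obtain ⟨y, hy⟩ := hg (h a)
    exact ⟨⟨(a, y), hE.mpr hy.symm⟩, rfl⟩
  have hET : ModuleCat.of Λ E ∈ T := by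
    refine hT.ext_ker π hπ (hT.quot hK (LinearMap.codRestrict _
      (LinearMap.codRestrict E (LinearMap.inr Λ P Y ∘ₗ Submodule.subtype _) fun y => ?_)
        fun y => ?_) ?_) hp.mem
    · exact hE.mpr ((map_zero h).trans (LinearMap.mem_ker.mp y.2).symm)
    · rfl
    · rintro ⟨⟨⟨a, y⟩, hay⟩, h0⟩
      obtain rfl : a = 0 := h0
      have hy : g y = 0 := by rw [← hE.mp hay, map_zero]
      exact ⟨⟨y, hy⟩, rfl⟩
  obtain ⟨y, hy⟩ := hg (h p)
  obtain ⟨ψ, hψ⟩ := hp.exists_map E hET ⟨(p, y), hE.mpr hy.symm⟩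
  let θ := LinearEquiv.ofBijective (π ∘ₗ ψ) (hp.bijective (π ∘ₗ ψ) (by simp [hψ, π]))
  refine ⟨LinearMap.snd Λ P Y ∘ₗ E.subtype ∘ₗ ψ ∘ₗ θ.symm.toLinearMap, ?_⟩
  ext a
  have h1 : h (ψ (θ.symm a)).1.1 = g (ψ (θ.symm a)).1.2 := hE.mp (ψ (θ.symm a)).2
  have h2 : (ψ (θ.symm a)).1.1 = a := θ.apply_symm_apply a
  rw [h2] at h1
  exact h1.symm

theorem IsMinimalApprox.isExtProjective_quotient (hT : IsNonemptyTorsion T)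
    (hp : IsMinimalApprox T p) : IsExtProjective T (P ⧸ Submodule.span Λ {p}) := by
  intro Y Z _ _ _ _ g hg hK h
  obtain ⟨φ, hφ⟩ := hp.isExtProjective hT Y Z g hg hK (h ∘ₗ Submodule.mkQ _)
  have hφp : g (φ p) = 0 := by
    have := LinearMap.congr_fun hφ p
    simpa [(Submodule.Quotient.mk_eq_zero _).mpr (Submodule.mem_span_singleton_self p)] using this
  obtain ⟨ψ, hψ⟩ := hp.exists_map _ hK ⟨φ p, hφp⟩
  refine ⟨Submodule.liftQ _ (φ - Submodule.subtype _ ∘ₗ ψ) ?_, ?_⟩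
  · rw [Submodule.span_singleton_le_iff_mem]
    simp [hψ]
  · refine Submodule.linearMap_qext _ (LinearMap.ext fun a => ?_)
    have h1 := LinearMap.congr_fun hφ a
    have h2 : g (ψ a) = 0 := (ψ a).2
    simpa [h2] using h1

/-- An Ext-progenerator of a torsion class, characterised by the properties of its
endomorphism ring that are needed below. -/
structure IsExtProgenerator (T : Set (ModuleCat.{0} Λ)) (P : Type) [AddCommGroup P]
    [Module Λ P] : Prop where
  mem : ModuleCat.of Λ P ∈ T
  trace_eq_top : ∀ (X : Type) [AddCommGroup X] [Module Λ X], ModuleCat.of Λ X ∈ T →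
    ⨆ f : P →ₗ[Λ] X, LinearMap.range f = ⊤
  isExtProjective : IsExtProjective T P
  /-- The kernel of a right `add P`-approximation of a module in `T` is generated by `P`. -/
  exists_relation : ∀ (X : Type) [AddCommGroup X] [Module Λ X], ModuleCat.of Λ X ∈ T →
    ∀ (n : ℕ) (h : Fin n → P →ₗ[Λ] X),
      (∀ g : P →ₗ[Λ] X, ∃ e : Fin n → P →ₗ[Λ] P, ∑ i, h i ∘ₗ e i = g) →
      ∀ x : Fin n → P, ∑ i, h i (x i) = 0 →
        ∃ (e : Fin n → P →ₗ[Λ] P) (q : P), (∀ i, e i q = x i) ∧ ∑ i, h i ∘ₗ e i = 0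

theorem IsMinimalApprox.isExtProgenerator (hT : IsNonemptyTorsion T) (hp : IsMinimalApprox T p) :
    IsExtProgenerator T (P × (P ⧸ Submodule.span Λ {p})) := by
  set N := Submodule.span Λ {p}
  refine ⟨hT.prod hp.mem (hT.quot hp.mem N.mkQ N.mkQ_surjective), ?_, ?_, ?_⟩
  · refine fun X _ _ hX => top_le_iff.mp fun x _ => ?_
    obtain ⟨f, rfl⟩ := hp.exists_map X hX x
    exact le_iSup (fun g : P × (P ⧸ N) →ₗ[Λ] X => LinearMap.range g)
      (f ∘ₗ LinearMap.fst Λ P (P ⧸ N)) ⟨(p, 0), rfl⟩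
  · intro Y Z _ _ _ _ g hg hK h
    obtain ⟨a, ha⟩ := hp.isExtProjective hT Y Z g hg hK (h ∘ₗ LinearMap.inl _ _ _)
    obtain ⟨b, hb⟩ := hp.isExtProjective_quotient hT Y Z g hg hK (h ∘ₗ LinearMap.inr _ _ _)
    refine ⟨a.coprod b, ?_⟩
    rw [LinearMap.comp_coprod, ha, hb, ← LinearMap.comp_coprod, LinearMap.coprod_inl_inr,
      LinearMap.comp_id]
  · intro X _ _ hX n h hspan x hx
    obtain ⟨φ, hφ⟩ := hp.exists_map (Fin n → P × (P ⧸ N))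
      (hT.pi (hT.prod hp.mem (hT.quot hp.mem N.mkQ N.mkQ_surjective)) n) x
    let d : P ⧸ N →ₗ[Λ] X := N.liftQ (∑ i, h i ∘ₗ LinearMap.proj i ∘ₗ φ) (by
      rw [Submodule.span_singleton_le_iff_mem]
      simpa [hφ] using hx)
    obtain ⟨e, he⟩ := hspan (d ∘ₗ LinearMap.snd Λ P (P ⧸ N))
    refine ⟨fun i => LinearMap.proj i ∘ₗ φ ∘ₗ LinearMap.fst Λ P (P ⧸ N) -
      e i ∘ₗ LinearMap.inr Λ P (P ⧸ N) ∘ₗ N.mkQ ∘ₗ LinearMap.fst Λ P (P ⧸ N), (p, 0), ?_, ?_⟩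
    · intro i
      have : N.mkQ p = 0 := (Submodule.Quotient.mk_eq_zero _).mpr
        (Submodule.mem_span_singleton_self p)
      simp only [LinearMap.sub_apply, LinearMap.comp_apply, LinearMap.fst_apply, hφ, this,
        map_zero, sub_zero, LinearMap.proj_apply]
    · refine LinearMap.ext fun ⟨a, b⟩ => ?_
      have h1 := LinearMap.congr_fun he (0, N.mkQ a)
      have h2 : d (N.mkQ a) = ∑ i, h i (φ a i) := by simp [d]
      simp only [LinearMap.sum_apply, LinearMap.comp_apply, LinearMap.snd_apply, h2] at h1
      simp only [LinearMap.sum_apply, LinearMap.comp_apply, LinearMap.sub_apply, map_sub,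
        LinearMap.fst_apply, LinearMap.inr_apply, LinearMap.proj_apply, Finset.sum_sub_distrib,
        h1, sub_self, LinearMap.zero_apply]

end

end Approximation

section SimpleQuotient

variable {A : Type} [Ring A]

/-- A finitely generated module `H` over an artinian ring with `IH ≠ H`, where `I` is the
annihilator of a simple module `S`, has `S` as a quotient. -/
theorem exists_ne_zero_of_annihilator_smul_ne_top [IsArtinianRing A] {S H : Type}
    [AddCommGroup S] [Module A S] [IsSimpleModule A S] [AddCommGroup H] [Module A H]
    [Module.Finite A H]
    (hH : Module.annihilator A S • (⊤ : Submodule A H) ≠ ⊤) : ∃ f : H →ₗ[A] S, f ≠ 0 := by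
  classical
  obtain ⟨M, hM, hle⟩ := (eq_top_or_exists_le_coatom _).resolve_left hH
  have hQ : IsSimpleModule A (H ⧸ M) := isSimpleModule_iff_isCoatom.mpr hM
  have : Nontrivial (H ⧸ M) := IsSimpleModule.nontrivial A _
  obtain ⟨q, hq⟩ := exists_ne (0 : H ⧸ M)
  have hann : ∀ a ∈ Module.annihilator A S, a • q = 0 := by
    intro a ha
    obtain ⟨x, rfl⟩ := M.mkQ_surjective q
    rw [← map_smul]
    exact (Submodule.Quotient.mk_eq_zero M).mpr
      (hle (Submodule.smul_mem_smul ha (Submodule.mem_top : x ∈ (⊤ : Submodule A H))))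
  let K : Finset S → Submodule A A := fun F =>
    LinearMap.ker (LinearMap.pi fun s : F => LinearMap.toSpanSingleton A S s.1)
  have hK : ∀ F a, a ∈ K F ↔ ∀ s ∈ F, a • s = 0 := by
    intro F a
    simp [K, funext_iff]
  obtain ⟨_, ⟨F, rfl⟩, hmin⟩ := IsArtinian.set_has_minimal (Set.range K) ⟨_, ∅, rfl⟩
  have hF : K F ≤ Module.annihilator A S := by
    intro a ha
    rw [Module.mem_annihilator]
    intro s
    have hle : K (insert s F) ≤ K F := fun b hb =>
      (hK F b).mpr fun t ht => (hK _ b).mp hb t (Finset.mem_insert_of_mem ht)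
    have heq := eq_of_le_of_not_lt hle (hmin _ ⟨_, rfl⟩)
    rw [← heq] at ha
    exact (hK _ a).mp ha s (Finset.mem_insert_self s F)
  let D : A →ₗ[A] F → S := LinearMap.pi fun s : F => LinearMap.toSpanSingleton A S s.1
  let χ : LinearMap.range D →ₗ[A] H ⧸ M :=
    (LinearMap.ker D).liftQ (LinearMap.toSpanSingleton A _ q)
      (fun a ha => hann a (hF ha)) ∘ₗ D.quotKerEquivRange.symm.toLinearMap
  obtain ⟨ψ, hψ⟩ := IsSemisimpleModule.extension_property (LinearMap.range D).subtype
    Subtype.val_injective χ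
  have hψ1 : ψ (D 1) = q := by
    have h1 := LinearMap.congr_fun hψ ⟨D 1, 1, rfl⟩
    have h2 : D.quotKerEquivRange.symm ⟨D 1, 1, rfl⟩ = (LinearMap.ker D).mkQ 1 :=
      (LinearEquiv.symm_apply_eq _).mpr rfl
    refine h1.trans ?_
    simp only [χ, LinearMap.comp_apply, LinearEquiv.coe_coe]
    rw [h2]
    exact one_smul A q
  obtain ⟨s, hs⟩ : ∃ s : F, ψ ∘ₗ LinearMap.single A (fun _ => S) s ≠ 0 := by
    by_contra! h0
    refine hq ?_
    rw [← hψ1, show D 1 = ∑ i, Pi.single i (D 1 i) from (Finset.univ_sum_single _).symm, map_sum]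
    exact Finset.sum_eq_zero fun i _ => LinearMap.congr_fun (h0 i) _
  let e := LinearEquiv.ofBijective _ (LinearMap.bijective_of_ne_zero hs)
  refine ⟨e.symm.toLinearMap ∘ₗ M.mkQ, fun h0 => ?_⟩
  obtain ⟨x, rfl⟩ := M.mkQ_surjective q
  exact hq (e.symm.map_eq_zero_iff.mp (LinearMap.congr_fun h0 x))

end SimpleQuotient

section Mutation

variable {Λ : Type} [Ring Λ] {T U : Set (ModuleCat.{0} Λ)}
variable {P X Y B : Type} [AddCommGroup P] [Module Λ P] [AddCommGroup X] [Module Λ X]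
  [AddCommGroup Y] [Module Λ Y] [AddCommGroup B] [Module Λ B]

theorem exists_comp_eq_of_ker_le (g : X →ₗ[Λ] Y) (hg : Function.Surjective g) (f : X →ₗ[Λ] B)
    (h : LinearMap.ker g ≤ LinearMap.ker f) : ∃ f' : Y →ₗ[Λ] B, ∀ x, f' (g x) = f x := by
  refine ⟨(LinearMap.ker g).liftQ f h ∘ₗ (g.quotKerEquivOfSurjective hg).symm.toLinearMap,
    fun x => ?_⟩
  have : (g.quotKerEquivOfSurjective hg).symm (g x) = (LinearMap.ker g).mkQ x :=
    (LinearEquiv.symm_apply_eq _).mpr rfl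
  simp [this]

/-- `Hom(P, X)` as a right module over `End(P)`. -/
instance homModule : Module (Module.End Λ P)ᵐᵒᵖ (P →ₗ[Λ] X) where
  smul a h := h ∘ₗ a.unop
  one_smul h := LinearMap.comp_id h
  mul_smul _ _ _ := rfl
  smul_zero _ := LinearMap.zero_comp _
  smul_add _ _ _ := LinearMap.add_comp _ _ _
  add_smul _ _ _ := LinearMap.comp_add _ _ _
  zero_smul _ := LinearMap.comp_zero _

theorem isArtinianRing_end_and_finite_hom (k : Type) [Field k] [Algebra k Λ]
    [FiniteDimensional k Λ] [Module.Finite Λ P] [Module.Finite Λ X] :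
    IsArtinianRing (Module.End Λ P)ᵐᵒᵖ ∧
      Module.Finite (Module.End Λ P)ᵐᵒᵖ (P →ₗ[Λ] X) := by
  let _ : Module k P := Module.compHom P (algebraMap k Λ)
  have : IsScalarTower k Λ P := ⟨fun a b x => by
    rw [Algebra.smul_def, mul_smul]
    rfl⟩
  let _ : Module k X := Module.compHom X (algebraMap k Λ)
  have : IsScalarTower k Λ X := ⟨fun a b x => by
    rw [Algebra.smul_def, mul_smul]
    rfl⟩
  have : Module.Finite k P := Module.Finite.trans Λ P
  have : Module.Finite k X := Module.Finite.trans Λ X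
  have : Module.Finite k (Module.End Λ P) :=
    Module.Finite.of_injective (LinearMap.restrictScalarsₗ k Λ P P k)
      (LinearMap.restrictScalars_injective k)
  have : Module.Finite k (P →ₗ[Λ] X) :=
    Module.Finite.of_injective (LinearMap.restrictScalarsₗ k Λ P X k)
      (LinearMap.restrictScalars_injective k)
  have : IsScalarTower k (Module.End Λ P)ᵐᵒᵖ (P →ₗ[Λ] X) := ⟨fun c a h => by
    ext x
    exact LinearMap.map_smul_of_tower h c (a.unop x)⟩
  have : Module.Finite k (Module.End Λ P)ᵐᵒᵖ :=
    Module.Finite.equiv (MulOpposite.opLinearEquiv k)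
  exact ⟨IsArtinianRing.of_finite k _, Module.Finite.of_restrictScalars_finite k _ _⟩

/-- The functor `Hom(P, -)` is full on a torsion class with Ext-progenerator `P`. -/
theorem IsExtProgenerator.exists_map (hP : IsExtProgenerator T P) (hX : ModuleCat.of Λ X ∈ T)
    [Module.Finite (Module.End Λ P)ᵐᵒᵖ (P →ₗ[Λ] X)]
    (θ : (P →ₗ[Λ] X) →ₗ[(Module.End Λ P)ᵐᵒᵖ] (P →ₗ[Λ] B)) :
    ∃ φ : X →ₗ[Λ] B, ∀ h, φ ∘ₗ h = θ h := by
  obtain ⟨n, h, hh⟩ := Module.Finite.exists_fin (R := (Module.End Λ P)ᵐᵒᵖ) (M := P →ₗ[Λ] X)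
  have hspan : ∀ g : P →ₗ[Λ] X, ∃ e : Fin n → P →ₗ[Λ] P, ∑ i, h i ∘ₗ e i = g := by
    intro g
    obtain ⟨c, hc⟩ := (Submodule.mem_span_range_iff_exists_fun _).mp
      (hh ▸ Submodule.mem_top : g ∈ _)
    exact ⟨fun i => (c i).unop, hc⟩
  let σ : (Fin n → P) →ₗ[Λ] X := ∑ i, h i ∘ₗ LinearMap.proj i
  let τ : (Fin n → P) →ₗ[Λ] B := ∑ i, θ (h i) ∘ₗ LinearMap.proj i
  have hσ : Function.Surjective σ := by
    refine LinearMap.range_eq_top.mp (top_le_iff.mp ?_)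
    rw [← hP.trace_eq_top X hX]
    refine iSup_le fun g => ?_
    obtain ⟨e, rfl⟩ := hspan g
    rintro _ ⟨x, rfl⟩
    exact ⟨fun i => e i x, by simp [σ]⟩
  have hθ : ∀ e : Fin n → P →ₗ[Λ] P, θ (∑ i, h i ∘ₗ e i) = ∑ i, θ (h i) ∘ₗ e i := by
    intro e
    rw [map_sum]
    exact Finset.sum_congr rfl fun i _ => θ.map_smul (MulOpposite.op (e i)) (h i)
  have hker : LinearMap.ker σ ≤ LinearMap.ker τ := by
    intro x hx
    obtain ⟨e, q, he, h0⟩ := hP.exists_relation X hX n h hspan x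
      (by simpa [σ] using hx)
    have h1 := hθ e
    rw [h0, map_zero] at h1
    have h2 := LinearMap.congr_fun h1 q
    simp only [LinearMap.zero_apply, LinearMap.sum_apply, LinearMap.comp_apply, he] at h2
    simp [τ, ← h2]
  obtain ⟨φ, hφ⟩ := exists_comp_eq_of_ker_le σ hσ τ hker
  refine ⟨φ, fun g => ?_⟩
  obtain ⟨e, rfl⟩ := hspan g
  rw [hθ]
  ext x
  have := hφ fun i => e i x
  simpa [σ, τ] using this

/-- The modules in `T` without nonzero maps to `B`. -/
def leftPerp (T : Set (ModuleCat.{0} Λ)) (B : Type) [AddCommGroup B] [Module Λ B] :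
    Set (ModuleCat.{0} Λ) :=
  {X | X ∈ T ∧ ∀ f : ↥X →ₗ[Λ] B, f = 0}

theorem isNonemptyTorsion_leftPerp (hT : IsNonemptyTorsion T) :
    IsNonemptyTorsion (leftPerp T B) := by
  refine ⟨⟨fun X hX => hT.isTorsionClass.1 X hX.1, fun X hX Y f hf => ⟨hT.isTorsionClass.2.1 X
    hX.1 Y f hf, fun g => ?_⟩, fun X Y Z f g hfg hX hZ => ⟨hT.isTorsionClass.2.2 X Y Z f g hfg
    hX.1 hZ.1, fun h => ?_⟩⟩, ModuleCat.of Λ PUnit, hT.of_subsingleton, fun f => ?_⟩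
  · ext y
    obtain ⟨x, rfl⟩ := hf y
    exact LinearMap.congr_fun (hX.2 (g ∘ₗ f)) x
  · obtain ⟨h', hh'⟩ := exists_comp_eq_of_ker_le g hfg.2.1 h (by
      rw [← hfg.2.2]
      rintro _ ⟨x, rfl⟩
      exact LinearMap.congr_fun (hX.2 (h ∘ₗ f)) x)
    ext y
    rw [← hh' y, hZ.2 h']
    rfl
  · ext
    exact map_zero f

/-- The submodule `NP` of `P` for a right ideal `N` of `End(P)`. -/
def idealTrace (N : Ideal (Module.End Λ P)ᵐᵒᵖ) : Submodule Λ P :=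
  ⨆ f ∈ {f : P →ₗ[Λ] P | MulOpposite.op f ∈ N}, LinearMap.range f

theorem apply_mem_idealTrace {N : Ideal (Module.End Λ P)ᵐᵒᵖ} {a : (Module.End Λ P)ᵐᵒᵖ}
    (ha : a ∈ N) (x : P) : a.unop x ∈ idealTrace N :=
  (le_iSup₂_of_le (f := fun (f : P →ₗ[Λ] P) (_ : f ∈ {f | MulOpposite.op f ∈ N}) =>
    LinearMap.range f) a.unop ha le_rfl) ⟨x, rfl⟩

theorem idealTrace_le {N : Ideal (Module.End Λ P)ᵐᵒᵖ} {Q : Submodule Λ P}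
    (h : ∀ a ∈ N, ∀ x, a.unop x ∈ Q) : idealTrace N ≤ Q := by
  refine iSup₂_le fun f hf => ?_
  rintro _ ⟨x, rfl⟩
  exact h _ hf x

theorem IsNonemptyTorsion.idealTrace_mem [IsArtinianRing Λ] (hT : IsNonemptyTorsion T)
    (hP : ModuleCat.of Λ P ∈ T) (N : Ideal (Module.End Λ P)ᵐᵒᵖ) :
    ModuleCat.of Λ (idealTrace N) ∈ T :=
  have := hT.finite hP
  hT.mem_trace hP _

/-- If `B` is a module such that `Hom(P, B)` is a simple `End(P)`-module, then
`T ∩ ^⊥B` is functorially finite. -/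
theorem IsExtProgenerator.isFacFinite_leftPerp (k : Type) [Field k] [Algebra k Λ]
    [FiniteDimensional k Λ] [IsArtinianRing Λ] (hT : IsNonemptyTorsion T)
    (hP : IsExtProgenerator T P)
    [IsSimpleModule (Module.End Λ P)ᵐᵒᵖ (P →ₗ[Λ] B)] :
    IsFacFinite Λ (leftPerp T B) := by
  have := hT.finite hP.mem
  have : IsArtinianRing (Module.End Λ P)ᵐᵒᵖ :=
    (isArtinianRing_end_and_finite_hom k (P := P) (X := P)).1
  set I := Module.annihilator (Module.End Λ P)ᵐᵒᵖ (P →ₗ[Λ] B) with hI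
  have hIX : ∀ X : ModuleCat.{0} Λ, X ∈ leftPerp T B →
      I • (⊤ : Submodule (Module.End Λ P)ᵐᵒᵖ (P →ₗ[Λ] X)) = ⊤ := by
    intro X hX
    have : Module.Finite Λ X := hT.finite (X := X) hX.1
    have := (isArtinianRing_end_and_finite_hom (Λ := Λ) k (P := P) (X := X)).2
    by_contra hne
    obtain ⟨θ, hθ⟩ := exists_ne_zero_of_annihilator_smul_ne_top hne
    obtain ⟨φ, hφ⟩ := hP.exists_map (X := X) hX.1 θ
    refine hθ (LinearMap.ext fun h => ?_)
    rw [← hφ h, hX.2 φ, LinearMap.zero_comp]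
    rfl
  obtain ⟨J, hJ, hmin⟩ := IsArtinian.set_has_minimal
    {J : Ideal (Module.End Λ P)ᵐᵒᵖ | ∀ X : ModuleCat.{0} Λ, X ∈ leftPerp T B →
      J • (⊤ : Submodule (Module.End Λ P)ᵐᵒᵖ (P →ₗ[Λ] X)) = ⊤}
    ⟨⊤, fun X _ => Submodule.top_smul _⟩
  have hIJ : I • J = J := eq_of_le_of_not_lt Submodule.smul_le_right <| hmin _ fun X hX => by
    rw [Submodule.smul_assoc, hJ X hX, hIX X hX]
  have hmem : ModuleCat.of Λ (idealTrace J) ∈ leftPerp T B := by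
    refine ⟨hT.idealTrace_mem hP.mem J, fun (f : idealTrace J →ₗ[Λ] B) => ?_⟩
    have key : ∀ a ∈ J, ∃ ha : a ∈ J, ∀ x, f ⟨a.unop x, apply_mem_idealTrace ha x⟩ = 0 := by
      intro a ha
      rw [← hIJ] at ha
      refine Submodule.smul_induction_on ha ?_ ?_
      · intro i hi j hj
        let g : P →ₗ[Λ] B := f ∘ₗ LinearMap.codRestrict (idealTrace J) j.unop
          fun x => apply_mem_idealTrace hj x
        exact ⟨J.smul_mem i hj, fun x =>
          LinearMap.congr_fun (Module.mem_annihilator.mp hi g) x⟩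
      · rintro b c ⟨hb, hb0⟩ ⟨hc, hc0⟩
        refine ⟨J.add_mem hb hc, fun x => ?_⟩
        have := map_add f ⟨b.unop x, apply_mem_idealTrace hb x⟩
          ⟨c.unop x, apply_mem_idealTrace hc x⟩
        rw [hb0, hc0, add_zero] at this
        exact this
    have hle : idealTrace J ≤ (LinearMap.ker f).map (idealTrace J).subtype :=
      idealTrace_le fun a ha x => by
        obtain ⟨ha', h0⟩ := key a ha
        exact ⟨_, h0 x, rfl⟩
    ext ⟨y, hy⟩
    obtain ⟨⟨z, hz⟩, h0, rfl⟩ := hle hy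
    exact h0
  refine ⟨ModuleCat.of Λ (idealTrace J), hT.finite hmem.1, ?_⟩
  refine Set.Subset.antisymm (fun X hX => ?_) ((isNonemptyTorsion_leftPerp hT).fac_subset hmem)
  have : Module.Finite Λ X := hT.finite (X := X) hX.1
  refine mem_fac_of_trace (X := X) (Y := idealTrace J) (s := Set.univ) (top_le_iff.mp ?_)
  rw [← hP.trace_eq_top X hX.1]
  refine iSup_le fun g => ?_
  have hg : g ∈ J • (⊤ : Submodule (Module.End Λ P)ᵐᵒᵖ (P →ₗ[Λ] X)) := by
    rw [hJ X hX]
    trivial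
  refine Submodule.smul_induction_on (p := fun g : P →ₗ[Λ] X => LinearMap.range g ≤
    ⨆ f ∈ (Set.univ : Set (idealTrace J →ₗ[Λ] X)), LinearMap.range f) hg ?_ ?_
  · rintro j hj h - _ ⟨x, rfl⟩
    refine (le_iSup₂_of_le (f := fun (f : idealTrace J →ₗ[Λ] X) (_ : f ∈ Set.univ) =>
      LinearMap.range f) (h ∘ₗ (idealTrace J).subtype) trivial le_rfl) ?_
    exact ⟨⟨_, apply_mem_idealTrace hj x⟩, rfl⟩
  · rintro h h' h1 h2 _ ⟨x, rfl⟩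
    exact add_mem (h1 ⟨x, rfl⟩) (h2 ⟨x, rfl⟩)

/-- The image in `P` of a right multiple. -/
theorem idealTrace_sup_span_le {N : Ideal (Module.End Λ P)ᵐᵒᵖ} (n : (Module.End Λ P)ᵐᵒᵖ) :
    idealTrace (N ⊔ Ideal.span {n}) ≤ idealTrace N ⊔ LinearMap.range n.unop := by
  refine idealTrace_le fun a ha x => ?_
  obtain ⟨b, hb, c, hc, rfl⟩ := Submodule.mem_sup.mp ha
  obtain ⟨d, rfl⟩ := Ideal.mem_span_singleton'.mp hc
  exact Submodule.add_mem_sup (apply_mem_idealTrace hb x) ⟨d.unop x, rfl⟩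

/-- If `U` is strictly contained in a functorially finite torsion class `T`, then there is a
functorially finite torsion class strictly below `T` containing `U`. -/
theorem IsNonemptyTorsion.exists_isFTorsionClass_lt (k : Type) [Field k] [Algebra k Λ]
    [FiniteDimensional k Λ] [IsArtinianRing Λ] (hT : IsNonemptyTorsion T)
    (hfac : IsFacFinite Λ T) (hU : IsNonemptyTorsion U) (hUT : U ⊆ T) (hne : U ≠ T) :
    ∃ G, IsFTorsionClass Λ G ∧ U ⊆ G ∧ G ⊆ T ∧ G ≠ T := by
  by_contra! hno
  obtain ⟨P₀, p, hp⟩ := hT.exists_isMinimalApprox k hfac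
  obtain ⟨P, _, _, hP⟩ : ∃ (P : Type) (_ : AddCommGroup P) (_ : Module Λ P),
    IsExtProgenerator T P := ⟨_, _, _, hp.isExtProgenerator hT⟩
  have := hT.finite hP.mem
  have hart : IsArtinianRing (Module.End Λ P)ᵐᵒᵖ :=
    (isArtinianRing_end_and_finite_hom k (P := P) (X := P)).1
  have hmax : ∀ M : Ideal (Module.End Λ P)ᵐᵒᵖ, IsCoatom M →
      ModuleCat.of Λ (P ⧸ idealTrace M) ∈ U := by
    intro M hM
    have hB : ModuleCat.of Λ (P ⧸ idealTrace M) ∈ T :=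
      hT.quot hP.mem _ (idealTrace M).mkQ_surjective
    let θ : (Module.End Λ P)ᵐᵒᵖ →ₗ[(Module.End Λ P)ᵐᵒᵖ] (P →ₗ[Λ] P ⧸ idealTrace M) :=
      LinearMap.toSpanSingleton _ _ (idealTrace M).mkQ
    have hθ : Function.Surjective θ := by
      intro h
      obtain ⟨h', hh'⟩ := hP.isExtProjective P (P ⧸ idealTrace M) (idealTrace M).mkQ
        (idealTrace M).mkQ_surjective (by
          rw [Submodule.ker_mkQ]
          exact hT.idealTrace_mem hP.mem M) h
      exact ⟨MulOpposite.op h', hh'⟩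
    have hle : M ≤ LinearMap.ker θ := fun a ha => LinearMap.ext fun x =>
      (Submodule.Quotient.mk_eq_zero _).mpr (apply_mem_idealTrace ha x)
    by_cases hker : LinearMap.ker θ = ⊤
    · have h1 : (idealTrace M).mkQ = 0 := by
        have : (1 : (Module.End Λ P)ᵐᵒᵖ) ∈ LinearMap.ker θ := hker ▸ trivial
        simpa [θ] using this
      have : Subsingleton (P ⧸ idealTrace M) := by
        rw [Submodule.Quotient.subsingleton_iff, ← (idealTrace M).ker_mkQ, h1,
          LinearMap.ker_zero]
      exact hU.of_subsingleton
    have hMθ : M = LinearMap.ker θ := (hM.le_iff.mp hle).resolve_left hker |>.symm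
    have : IsSimpleModule (Module.End Λ P)ᵐᵒᵖ ((Module.End Λ P)ᵐᵒᵖ ⧸ LinearMap.ker θ) :=
      isSimpleModule_iff_isCoatom.mpr (hMθ ▸ hM)
    have : IsSimpleModule (Module.End Λ P)ᵐᵒᵖ (P →ₗ[Λ] P ⧸ idealTrace M) :=
      IsSimpleModule.congr (θ.quotKerEquivOfSurjective hθ).symm
    obtain ⟨X, hXU, f, hf⟩ : ∃ X ∈ U, ∃ f : X →ₗ[Λ] P ⧸ idealTrace M, f ≠ 0 := by
      by_contra! h0
      have hG := hno (leftPerp T (P ⧸ idealTrace M))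
        ⟨(isNonemptyTorsion_leftPerp hT).isTorsionClass, hP.isFacFinite_leftPerp k hT⟩
        (fun X hX => ⟨hUT hX, h0 X hX⟩) fun X hX => hX.1
      have := (hG.symm ▸ hB : ModuleCat.of Λ (P ⧸ idealTrace M) ∈ leftPerp T _).2 LinearMap.id
      refine hker (top_le_iff.mp fun a _ => ?_)
      exact (LinearMap.ext fun x => LinearMap.congr_fun this _ : θ a = 0)
    let W : Submodule (Module.End Λ P)ᵐᵒᵖ (P →ₗ[Λ] P ⧸ idealTrace M) :=
      { carrier := {h | LinearMap.range h ≤ LinearMap.range f}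
        zero_mem' := by simp
        add_mem' := by
          rintro g h hg hh _ ⟨x, rfl⟩
          exact add_mem (hg ⟨x, rfl⟩) (hh ⟨x, rfl⟩)
        smul_mem' := by
          rintro a h hh _ ⟨x, rfl⟩
          exact hh ⟨a.unop x, rfl⟩ }
    have hR := hU.range (X := X) hXU f
    have hW : W = ⊤ := by
      refine (eq_bot_or_eq_top W).resolve_left fun hW => hf ?_
      have htr := hP.trace_eq_top (LinearMap.range f) (hUT hR)
      have : (⊤ : Submodule Λ (LinearMap.range f)) ≤ ⊥ := by
        rw [← htr]
        refine iSup_le fun g => ?_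
        have hg : (LinearMap.range f).subtype ∘ₗ g ∈ W := by
          rintro _ ⟨x, rfl⟩
          exact (g x).2
        rw [hW, Submodule.mem_bot] at hg
        rintro _ ⟨x, rfl⟩
        exact Subtype.ext (LinearMap.congr_fun hg x)
      ext x
      exact congrArg Subtype.val (this (trivial : (⟨f x, x, rfl⟩ : LinearMap.range f) ∈ _))
    have htop : LinearMap.range f = ⊤ := by
      refine top_le_iff.mp ?_
      rw [← hP.trace_eq_top _ hB]
      exact iSup_le fun g => (hW ▸ trivial : g ∈ W)
    exact hU.quot (X := X) hXU f (LinearMap.range_eq_top.mp htop)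
  obtain ⟨N, hN, hmin⟩ := IsArtinian.set_has_minimal
    {N : Ideal (Module.End Λ P)ᵐᵒᵖ | ModuleCat.of Λ (P ⧸ idealTrace N) ∈ U}
    ⟨⊤, by
      have : idealTrace (⊤ : Ideal (Module.End Λ P)ᵐᵒᵖ) = ⊤ :=
        top_le_iff.mp fun x _ => apply_mem_idealTrace (N := ⊤) (a := 1) trivial x
      have : Subsingleton (P ⧸ idealTrace (⊤ : Ideal (Module.End Λ P)ᵐᵒᵖ)) := by
        rwa [Submodule.Quotient.subsingleton_iff]
      exact hU.of_subsingleton⟩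
  change ModuleCat.of Λ (P ⧸ idealTrace N) ∈ U at hN
  by_cases hbot : N = ⊥
  · subst hbot
    have hPU : ModuleCat.of Λ P ∈ U := by
      refine hU.ext _ ?_ hN
      have : Subsingleton (idealTrace (⊥ : Ideal (Module.End Λ P)ᵐᵒᵖ)) := by
        rw [Submodule.subsingleton_iff_eq_bot]
        refine le_bot_iff.mp (idealTrace_le fun a ha x => ?_)
        rw [(Submodule.mem_bot _).mp ha]
        exact Submodule.zero_mem _
      exact hU.of_subsingleton
    refine hne (hUT.antisymm fun X hX => ?_)
    have : Module.Finite Λ X := hT.finite (X := X) hX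
    refine hU.mem_of_trace (X := X) hPU (s := Set.univ) ?_
    rw [← hP.trace_eq_top X hX]
    simp
  obtain ⟨N', hN', hmax'⟩ := set_has_maximal_iff_noetherian.mpr
    (inferInstanceAs (IsNoetherianRing (Module.End Λ P)ᵐᵒᵖ))
    {N' : Ideal (Module.End Λ P)ᵐᵒᵖ | N' < N} ⟨⊥, bot_lt_iff_ne_bot.mpr hbot⟩
  refine hmin N' ?_ hN'
  change N' < N at hN'
  obtain ⟨n, hnN, hn⟩ := SetLike.exists_of_lt hN'
  have hsup : ∀ m ∈ N, m ∉ N' → N' ⊔ Ideal.span {m} = N := by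
    intro m hmN hm
    have hle : N' ⊔ Ideal.span {m} ≤ N :=
      sup_le hN'.le ((Ideal.span_singleton_le_iff_mem _).mpr hmN)
    refine eq_of_le_of_not_lt hle fun hlt => hmax' _ hlt ?_
    exact lt_of_le_not_ge le_sup_left fun h =>
      hm (h (Ideal.mem_sup_right (Ideal.mem_span_singleton_self m)))
  have hspan := hsup n hnN hn
  let M : Ideal (Module.End Λ P)ᵐᵒᵖ := Submodule.comap (LinearMap.toSpanSingleton _ _ n) N'
  have hM : IsCoatom M := by
    refine ⟨fun h => hn ?_, fun L hL => ?_⟩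
    · have : (1 : (Module.End Λ P)ᵐᵒᵖ) * n ∈ N' := (h ▸ trivial : (1 : (Module.End Λ P)ᵐᵒᵖ) ∈ M)
      rwa [one_mul] at this
    obtain ⟨l, hlL, hl⟩ := SetLike.exists_of_lt hL
    have hn' := hnN
    rw [← hsup (l * n) (N.smul_mem l hnN) hl] at hn'
    obtain ⟨n', hn'N, c, hc, hnc⟩ := Submodule.mem_sup.mp hn'
    obtain ⟨b, rfl⟩ := Ideal.mem_span_singleton'.mp hc
    have hb : 1 - b * l ∈ M := by
      change (1 - b * l) * n ∈ N'
      rwa [sub_mul, one_mul, mul_assoc, sub_eq_iff_eq_add.mpr hnc.symm]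
    rw [Ideal.eq_top_iff_one]
    simpa using L.add_mem (hL.le hb) (L.smul_mem b hlL)
  change ModuleCat.of Λ (P ⧸ idealTrace N') ∈ U
  have hle : idealTrace N' ≤ idealTrace N :=
    idealTrace_le fun a ha x => apply_mem_idealTrace (hN'.le ha) x
  refine hU.ext_ker (Submodule.factor hle) (Submodule.factor_surjective hle) ?_ hN
  have hzero : idealTrace M ≤ LinearMap.ker ((idealTrace N').mkQ ∘ₗ n.unop) :=
    idealTrace_le fun a ha x => (Submodule.Quotient.mk_eq_zero _).mpr
      (apply_mem_idealTrace (show a * n ∈ N' from ha) x)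
  refine hU.quot (hmax M hM) ((idealTrace M).liftQ ((((idealTrace N').mkQ ∘ₗ n.unop).codRestrict
    (LinearMap.ker (Submodule.factor hle)) ?_)) ?_) ?_
  · intro x
    exact (Submodule.Quotient.mk_eq_zero _).mpr (apply_mem_idealTrace hnN x)
  · exact fun y hy => Subtype.ext (hzero hy)
  · rintro ⟨y, hy⟩
    obtain ⟨y, rfl⟩ := Submodule.mkQ_surjective _ y
    have hy' : y ∈ idealTrace N := (Submodule.Quotient.mk_eq_zero _).mp hy
    rw [← hspan] at hy'
    obtain ⟨z, hz, _, ⟨x, rfl⟩, rfl⟩ := Submodule.mem_sup.mp (idealTrace_sup_span_le n hy')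
    refine ⟨Submodule.Quotient.mk x, Subtype.ext ?_⟩
    change Submodule.Quotient.mk (n.unop x) = Submodule.Quotient.mk (z + n.unop x)
    rw [Submodule.Quotient.mk_add, (Submodule.Quotient.mk_eq_zero _).mpr hz, zero_add]

end Mutation

section Presentation

variable {Λ : Type} [Ring Λ] {T : Set (ModuleCat.{0} Λ)}
variable {F G K N P X : Type} [AddCommGroup F] [Module Λ F] [AddCommGroup G] [Module Λ G]
  [AddCommGroup K] [Module Λ K] [AddCommGroup N] [Module Λ N] [AddCommGroup P] [Module Λ P]
  [AddCommGroup X] [Module Λ X]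

/-- Ext-projectivity: maps from a syzygy of `P` to a module in `T` extend. -/
theorem IsExtProjective.exists_extend (hT : IsNonemptyTorsion T) (hP : IsExtProjective T P)
    (hN : ModuleCat.of Λ N ∈ T) (π : F →ₗ[Λ] P) (hπ : Function.Surjective π)
    (θ : LinearMap.ker π →ₗ[Λ] N) : ∃ θ' : F →ₗ[Λ] N, ∀ x, θ' x.1 = θ x := by
  let R := LinearMap.range ((LinearMap.ker π).subtype.prod (-θ))
  let g : (F × N) ⧸ R →ₗ[Λ] P := R.liftQ (π ∘ₗ LinearMap.fst Λ F N) (by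
    rintro _ ⟨x, rfl⟩
    exact x.2)
  let ι : N →ₗ[Λ] (F × N) ⧸ R := R.mkQ ∘ₗ LinearMap.inr Λ F N
  have hι : Function.Injective ι := by
    refine (injective_iff_map_eq_zero ι).mpr fun n hn => ?_
    obtain ⟨x, hx⟩ := (Submodule.Quotient.mk_eq_zero R).mp hn
    have h1 : x = 0 := Subtype.ext (congrArg Prod.fst hx)
    have h2 : -θ x = n := congrArg Prod.snd hx
    rw [← h2, h1, map_zero, neg_zero]
  have hrange : ∀ y, g y = 0 → ∃ n, ι n = y := by
    intro y hy
    obtain ⟨⟨f, n⟩, rfl⟩ := R.mkQ_surjective y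
    refine ⟨n + θ ⟨f, hy⟩, (Submodule.Quotient.eq R).mpr ⟨-⟨f, hy⟩, ?_⟩⟩
    ext <;> simp
  obtain ⟨s, hs⟩ := hP ((F × N) ⧸ R) P g
    (fun p => by
      obtain ⟨f, rfl⟩ := hπ p
      exact ⟨R.mkQ (f, 0), rfl⟩)
    (hT.quot hN (ι.codRestrict _ fun n => map_zero π) fun y => by
      obtain ⟨n, hn⟩ := hrange y.1 y.2
      exact ⟨n, Subtype.ext hn⟩) LinearMap.id
  let d : F →ₗ[Λ] (F × N) ⧸ R := R.mkQ ∘ₗ LinearMap.inl Λ F N - s ∘ₗ π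
  have hd : ∀ f, d f ∈ LinearMap.range ι := fun f => hrange _ (by
    have := LinearMap.congr_fun hs (π f)
    simp only [LinearMap.comp_apply, LinearMap.id_apply] at this
    simp only [d, LinearMap.sub_apply, LinearMap.comp_apply, map_sub, this]
    exact sub_self _)
  refine ⟨(LinearEquiv.ofInjective ι hι).symm.toLinearMap ∘ₗ d.codRestrict _ hd, fun x => ?_⟩
  refine (LinearEquiv.symm_apply_eq _).mpr (Subtype.ext ?_)
  change R.mkQ (x.1, 0) - s (π x.1) = R.mkQ (0, θ x)
  rw [show π x.1 = 0 from x.2, map_zero, sub_zero]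
  exact (Submodule.Quotient.eq R).mpr ⟨x, by ext <;> simp⟩

/-- A free module mapping onto `K` splits off a projective cover `ε F`. -/
theorem exists_idempotent [IsArtinianRing Λ] (m : ℕ) (q : (Fin m → Λ) →ₗ[Λ] K) :
    ∃ ε : (Fin m → Λ) →ₗ[Λ] (Fin m → Λ), ε ∘ₗ ε = ε ∧ q ∘ₗ ε = q ∧
      ∀ (X : Type) [AddCommGroup X] [Module Λ X] (h : (Fin m → Λ) →ₗ[Λ] X), h ∘ₗ ε = h →
        (∀ x, ∃ y, q y = 0 ∧ h y = h x) → h = 0 := by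
  obtain ⟨_, ⟨e, he, rfl⟩, hmin⟩ := IsArtinian.set_has_minimal
    {W | ∃ e : Module.End Λ (Fin m → Λ), q ∘ₗ e = q ∧ LinearMap.range e = W}
    ⟨_, LinearMap.id, LinearMap.comp_id q, rfl⟩
  have hpow : ∀ j, q ∘ₗ (e ^ j : Module.End Λ (Fin m → Λ)) = q := by
    intro j
    induction j with
    | zero => exact LinearMap.comp_id q
    | succ j ih =>
      rw [pow_succ, Module.End.mul_eq_comp, ← LinearMap.comp_assoc, ih, he]
  obtain ⟨j, hj⟩ := (e.eventually_isCompl_ker_pow_range_pow.and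
    (Filter.eventually_ge_atTop 1)).exists
  have hrange : LinearMap.range (e ^ j) = LinearMap.range e := by
    refine eq_of_le_of_not_lt ?_ (hmin _ ⟨_, hpow j, rfl⟩)
    obtain ⟨i, rfl⟩ := Nat.exists_eq_add_of_le hj.2
    rw [pow_add, pow_one]
    exact LinearMap.range_comp_le_range (e ^ i) e
  let ε := (LinearMap.range (e ^ j)).projection _ hj.1.symm
  have hqε : q ∘ₗ ε = q := by
    refine LinearMap.ext fun x => ?_
    have h1 : (e ^ j) (x - ε x) = 0 :=
      LinearMap.mem_ker.mp (Submodule.sub_projection_mem hj.1.symm x)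
    have h2 := LinearMap.congr_fun (hpow j) (x - ε x)
    rw [LinearMap.comp_apply, h1, map_zero, map_sub] at h2
    exact (sub_eq_zero.mp h2.symm).symm
  refine ⟨ε, Submodule.isIdempotentElem_projection _, hqε, fun X _ _ h hh hsup => ?_⟩
  choose t htq hth using fun i => hsup (Pi.single i 1)
  let t' : (Fin m → Λ) →ₗ[Λ] (Fin m → Λ) := Fintype.linearCombination Λ t
  have hqt : q ∘ₗ t' = 0 := by
    ext i
    simp [t', htq]
  have hht : h ∘ₗ t' = h := by
    ext i
    simp [t', hth]
  have hr : LinearMap.range (ε ∘ₗ (LinearMap.id - t')) = LinearMap.range e := by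
    refine eq_of_le_of_not_lt ?_ (hmin _ ⟨_, ?_, rfl⟩)
    · refine (LinearMap.range_comp_le_range _ _).trans ?_
      rw [Submodule.range_projection, hrange]
    · rw [← LinearMap.comp_assoc, hqε, LinearMap.comp_sub, hqt, sub_zero, LinearMap.comp_id]
  rw [← hrange, ← Submodule.range_projection hj.1.symm] at hr
  refine LinearMap.ext fun x => ?_
  obtain ⟨y, hy⟩ : ε x ∈ LinearMap.range (ε ∘ₗ (LinearMap.id - t')) := hr ▸ ⟨x, rfl⟩
  rw [← hh, LinearMap.comp_apply, ← hy, ← LinearMap.comp_apply, ← LinearMap.comp_assoc, hh,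
    LinearMap.comp_sub, hht]
  simp

/-- A two-term presentation of a torsion class: `T` consists of the modules `X` for which
`Hom(G, X) → Hom(εF, X)` is surjective. -/
structure IsPresentation (T : Set (ModuleCat.{0} Λ)) (a : F →ₗ[Λ] G) (ε : F →ₗ[Λ] F) : Prop where
  idem : ε ∘ₗ ε = ε
  comp_eq : a ∘ₗ ε = a
  exists_extend : ∀ (X : Type) [AddCommGroup X] [Module Λ X], ModuleCat.of Λ X ∈ T →
    ∀ h : F →ₗ[Λ] X, h ∘ₗ ε = h → ∃ z : G →ₗ[Λ] X, z ∘ₗ a = h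
  mem : ∀ (X : Type) [AddCommGroup X] [Module Λ X] [Module.Finite Λ X],
    (∀ h : F →ₗ[Λ] X, h ∘ₗ ε = h → ∃ z : G →ₗ[Λ] X, z ∘ₗ a = h) → ModuleCat.of Λ X ∈ T
  coker_mem : ModuleCat.of Λ (G ⧸ LinearMap.range a) ∈ T

theorem IsPresentation.comp_equiv {a : F →ₗ[Λ] G} {ε : F →ₗ[Λ] F} (h : IsPresentation T a ε)
    (e : K ≃ₗ[Λ] F) :
    IsPresentation T (a ∘ₗ e.toLinearMap) (e.symm.toLinearMap ∘ₗ ε ∘ₗ e.toLinearMap) := by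
  refine ⟨?_, ?_, fun X _ _ hX g hg => ?_, fun X _ _ _ hX => h.mem X fun g hg => ?_, ?_⟩
  · ext x
    have := LinearMap.congr_fun h.idem (e x)
    simpa using this
  · ext x
    have := LinearMap.congr_fun h.comp_eq (e x)
    simpa using this
  · obtain ⟨z, hz⟩ := h.exists_extend X hX (g ∘ₗ e.symm.toLinearMap) (by
      ext x
      have := LinearMap.congr_fun hg (e.symm x)
      simpa using this)
    refine ⟨z, ?_⟩
    rw [← LinearMap.comp_assoc, hz]
    ext x
    simp
  · obtain ⟨z, hz⟩ := hX (g ∘ₗ e.toLinearMap) (by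
      ext x
      have := LinearMap.congr_fun hg (e x)
      simpa using this)
    refine ⟨z, ?_⟩
    ext x
    have := LinearMap.congr_fun hz (e.symm x)
    simpa using this
  · rw [LinearMap.range_comp, LinearEquiv.range, Submodule.map_top]
    exact h.coker_mem

theorem IsNonemptyTorsion.exists_isPresentation (k : Type) [Field k] [Algebra k Λ]
    [FiniteDimensional k Λ] [IsArtinianRing Λ] (hT : IsNonemptyTorsion T)
    (hfac : IsFacFinite Λ T) :
    ∃ (m n : ℕ) (a : (Fin m → Λ) →ₗ[Λ] (Fin n → Λ)) (ε : (Fin m → Λ) →ₗ[Λ] (Fin m → Λ)),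
      IsPresentation T a ε := by
  obtain ⟨P₀, p, hp⟩ := hT.exists_isMinimalApprox k hfac
  obtain ⟨P, _, _, p, hp⟩ : ∃ (P : Type) (_ : AddCommGroup P) (_ : Module Λ P) (p : P),
    IsMinimalApprox T p := ⟨_, _, _, p, hp⟩
  have := hT.finite hp.mem
  obtain ⟨n, π, hπ⟩ := Module.Finite.exists_fin' Λ P
  obtain ⟨m, q, hq⟩ := Module.Finite.exists_fin' Λ (LinearMap.ker π)
  obtain ⟨ε, hε, hqε, hsup⟩ := exists_idempotent m q
  obtain ⟨g, hg⟩ := hπ p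
  have hext : ∀ (X : Type) [AddCommGroup X] [Module Λ X], ModuleCat.of Λ X ∈ T →
      ∀ h : (Fin m → Λ) →ₗ[Λ] X, h ∘ₗ ε = h →
        ∃ z : (Fin n → Λ) →ₗ[Λ] X, ∀ x, z (q x).1 = h x := by
    intro X _ _ hX h hh
    let L := (LinearMap.ker q).map h
    obtain ⟨θ, hθ⟩ := exists_comp_eq_of_ker_le q hq (L.mkQ ∘ₗ h) (by
      intro x hx
      exact (Submodule.Quotient.mk_eq_zero L).mpr ⟨x, hx, rfl⟩)
    obtain ⟨θ', hθ'⟩ := (hp.isExtProjective hT).exists_extend hT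
      (hT.quot hX L.mkQ L.mkQ_surjective) π hπ θ
    obtain ⟨z, hz⟩ := Module.projective_lifting_property L.mkQ θ' L.mkQ_surjective
    refine ⟨z, fun x => ?_⟩
    have h0 := hsup X (h - z ∘ₗ (LinearMap.ker π).subtype ∘ₗ q) (by
      rw [LinearMap.sub_comp, hh, LinearMap.comp_assoc, LinearMap.comp_assoc, hqε]) (by
      intro x
      have hx : h x - z (q x).1 ∈ L := by
        rw [← Submodule.Quotient.mk_eq_zero, Submodule.Quotient.mk_sub, sub_eq_zero]
        have h1 := LinearMap.congr_fun hz (q x).1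
        rw [hθ', hθ] at h1
        exact h1.symm
      obtain ⟨y, hy, hyx⟩ := hx
      refine ⟨y, hy, ?_⟩
      simp [hyx, LinearMap.mem_ker.mp hy])
    have := LinearMap.congr_fun h0 x
    exact (sub_eq_zero.mp this).symm
  let a : Λ × (Fin m → Λ) →ₗ[Λ] (Fin n → Λ) :=
    (LinearMap.toSpanSingleton Λ _ g).coprod ((LinearMap.ker π).subtype ∘ₗ q)
  have key : IsPresentation T a (LinearMap.prodMap LinearMap.id ε) := by
    refine ⟨?_, ?_, fun X _ _ hX h hh => ?_, fun X _ _ _ hX => ?_, ?_⟩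
    · rw [LinearMap.prodMap_comp, hε, LinearMap.id_comp]
    · refine LinearMap.prod_ext (by ext; simp [a]) (LinearMap.ext fun x => ?_)
      have := LinearMap.congr_fun hqε x
      rw [LinearMap.comp_apply] at this
      simp [a, this]
    · obtain ⟨z, hz⟩ := hext X hX (h ∘ₗ LinearMap.inr Λ Λ _) (by
        refine LinearMap.ext fun x => ?_
        have := LinearMap.congr_fun hh (0, x)
        simpa using this)
      obtain ⟨f, hf⟩ := hp.exists_map X hX (h (1, 0) - z g)
      refine ⟨z + f ∘ₗ π, ?_⟩
      refine LinearMap.prod_ext ?_ ?_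
      · ext
        simp [a, hg, hf]
      · refine LinearMap.ext fun x => ?_
        have hx : π (q x).1 = 0 := (q x).2
        simp [a, hz, hx]
    · refine hT.mem_of_trace hp.mem (s := Set.univ) (top_le_iff.mp fun x _ => ?_)
      obtain ⟨z, hz⟩ := hX ((LinearMap.toSpanSingleton Λ X x).coprod 0) (by
        ext <;> simp)
      obtain ⟨f, hf⟩ := exists_comp_eq_of_ker_le π hπ z fun y hy => by
        obtain ⟨w, hw⟩ := hq ⟨y, hy⟩
        have := LinearMap.congr_fun hz (0, w)
        simpa [a, hw] using this
      have hx := LinearMap.congr_fun hz (1, 0)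
      refine (le_iSup₂_of_le (f := fun (f : P →ₗ[Λ] X) (_ : f ∈ Set.univ) =>
        LinearMap.range f) f trivial le_rfl) ⟨p, ?_⟩
      rw [← hg, hf]
      simpa [a] using hx
    · obtain ⟨f, hf⟩ := exists_comp_eq_of_ker_le π hπ (LinearMap.range a).mkQ fun y hy => by
        obtain ⟨w, hw⟩ := hq ⟨y, hy⟩
        refine (Submodule.Quotient.mk_eq_zero _).mpr ⟨(0, w), ?_⟩
        simp [a, hw]
      refine hT.quot hp.mem f fun y => ?_
      obtain ⟨y, rfl⟩ := Submodule.mkQ_surjective _ y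
      exact ⟨_, hf y⟩
  exact ⟨m + 1, n, _, _, key.comp_equiv (Fin.consLinearEquiv Λ fun _ => Λ).symm⟩

end Presentation

section Duality

variable {k Λ Γ : Type} [Field k] [Ring Λ] [Algebra k Λ] [Ring Γ] [Algebra k Γ]

/-- The inverse anti-isomorphism. -/
def swap (τ : Γ ≃ₐ[k] Λᵐᵒᵖ) : Λ ≃ₐ[k] Γᵐᵒᵖ := (AlgEquiv.opComm τ).symm

variable (τ : Γ ≃ₐ[k] Λᵐᵒᵖ)

theorem unop_swap (a : Λ) : (swap τ a).unop = τ.symm (MulOpposite.op a) := rfl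

variable (k Λ) in
/-- The `k`-linear functionals on a `Λ`-module. -/
def functionals (X : Type) [AddCommGroup X] [Module Λ X] : AddSubgroup (X →+ k) where
  carrier := {φ | ∀ (c : k) (x : X), φ (algebraMap k Λ c • x) = c * φ x}
  zero_mem' := fun c _ => (mul_zero c).symm
  add_mem' := fun {φ ψ} hφ hψ c x => by
    rw [AddMonoidHom.add_apply, AddMonoidHom.add_apply, hφ, hψ, mul_add]
  neg_mem' := fun {φ} hφ c x => by
    rw [AddMonoidHom.neg_apply, AddMonoidHom.neg_apply, hφ, mul_neg]

/-- The `k`-dual of a `Λ`-module, as a module over the opposite algebra `Γ`. -/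
def KDual (_ : Γ ≃ₐ[k] Λᵐᵒᵖ) (X : Type) [AddCommGroup X] [Module Λ X] : Type :=
  functionals k Λ X

section Modules

variable {X Y : Type} [AddCommGroup X] [Module Λ X] [AddCommGroup Y] [Module Γ Y]

instance : AddCommGroup (KDual τ X) := inferInstanceAs (AddCommGroup (functionals k Λ X))

instance : FunLike (KDual τ X) X k where
  coe φ := φ.1
  coe_injective _ _ h := Subtype.ext (DFunLike.coe_injective h)

instance : AddMonoidHomClass (KDual τ X) X k where
  map_add φ := φ.1.map_add
  map_zero φ := φ.1.map_zero

variable {τ}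

theorem KDual.ext {φ ψ : KDual τ X} (h : ∀ x, φ x = ψ x) : φ = ψ := DFunLike.ext _ _ h

theorem KDual.add_apply (φ ψ : KDual τ X) (x : X) : (φ + ψ) x = φ x + ψ x := rfl

theorem KDual.zero_apply (x : X) : (0 : KDual τ X) x = 0 := rfl

theorem KDual.map_algebraMap_smul (φ : KDual τ X) (c : k) (x : X) :
    φ (algebraMap k Λ c • x) = c * φ x := φ.2 c x

/-- A `k`-linear functional on a `Λ`-module is an element of the dual. -/
def KDual.mk' [Module k X] [IsScalarTower k Λ X] (φ : X →ₗ[k] k) : KDual τ X :=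
  ⟨φ.toAddMonoidHom, fun c x => by
    rw [algebraMap_smul]
    exact φ.map_smul c x⟩

instance : Module Γ (KDual τ X) where
  smul γ φ := ⟨φ.1.comp (DistribSMul.toAddMonoidHom X (τ γ).unop), fun c x => by
    change φ ((τ γ).unop • algebraMap k Λ c • x) = c * φ ((τ γ).unop • x)
    rw [← mul_smul, ← Algebra.commutes, mul_smul, KDual.map_algebraMap_smul]⟩
  one_smul φ := KDual.ext fun x => by
    change φ ((τ 1).unop • x) = φ x
    rw [map_one, MulOpposite.unop_one, one_smul]
  mul_smul γ δ φ := KDual.ext fun x => by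
    change φ ((τ (γ * δ)).unop • x) = φ ((τ δ).unop • (τ γ).unop • x)
    rw [map_mul, MulOpposite.unop_mul, mul_smul]
  smul_zero _ := rfl
  smul_add _ _ _ := rfl
  add_smul γ δ φ := KDual.ext fun x => by
    change φ ((τ (γ + δ)).unop • x) = φ ((τ γ).unop • x) + φ ((τ δ).unop • x)
    rw [map_add, MulOpposite.unop_add, add_smul, map_add]
  zero_smul φ := KDual.ext fun x => by
    change φ ((τ 0).unop • x) = 0
    rw [map_zero, MulOpposite.unop_zero, zero_smul, map_zero]

theorem KDual.smul_apply (γ : Γ) (φ : KDual τ X) (x : X) : (γ • φ) x = φ ((τ γ).unop • x) := rfl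

theorem KDual.algebraMap_smul_apply (c : k) (φ : KDual τ X) (x : X) :
    (algebraMap k Γ c • φ) x = c * φ x := by
  rw [KDual.smul_apply, AlgEquiv.commutes]
  exact φ.map_algebraMap_smul c x

/-- Homomorphisms `Y → DX` correspond to homomorphisms `X → DY`. -/
def transpose (g : Y →ₗ[Γ] KDual τ X) : X →ₗ[Λ] KDual (swap τ) Y where
  toFun x := ⟨AddMonoidHom.mk' (fun y => g y x) fun y y' => DFunLike.congr_fun (g.map_add y y') x,
    fun c y => by
      change g (algebraMap k Γ c • y) x = c * g y x
      rw [g.map_smul, KDual.algebraMap_smul_apply]⟩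
  map_add' x x' := KDual.ext fun y => map_add (g y) x x'
  map_smul' a x := KDual.ext fun y => by
    change g y (a • x) = g ((swap τ a).unop • y) x
    rw [g.map_smul, KDual.smul_apply, unop_swap, AlgEquiv.apply_symm_apply, MulOpposite.unop_op]

theorem forall_eq_zero_iff_transpose :
    (∀ g : Y →ₗ[Γ] KDual τ X, g = 0) ↔ ∀ f : X →ₗ[Λ] KDual (swap τ) Y, f = 0 := by
  refine ⟨fun h f => ?_, fun h g => ?_⟩
  · have := h (transpose (τ := swap τ) f)
    ext x
    exact KDual.ext fun y => DFunLike.congr_fun (LinearMap.congr_fun this y) x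
  · have := h (transpose g)
    ext y
    exact KDual.ext fun x => DFunLike.congr_fun (LinearMap.congr_fun this x) y

variable (τ) in
theorem KDual.eq_zero_of_forall {x : X} (h : ∀ φ : KDual τ X, φ x = 0) : x = 0 := by
  let _ : Module k X := Module.compHom X (algebraMap k Λ)
  have : IsScalarTower k Λ X := ⟨fun a b x => by
    rw [Algebra.smul_def, mul_smul]
    rfl⟩
  exact (Module.forall_dual_apply_eq_zero_iff k x).mp fun φ => h (KDual.mk' φ)

/-- Evaluation `X → DDX`. -/
def evalDual (τ : Γ ≃ₐ[k] Λᵐᵒᵖ) (X : Type) [AddCommGroup X] [Module Λ X] :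
    X →ₗ[Λ] KDual (swap τ) (KDual τ X) := transpose LinearMap.id

theorem evalDual_injective : Function.Injective (evalDual τ X) :=
  (injective_iff_map_eq_zero _).mpr fun _ hx => KDual.eq_zero_of_forall τ fun φ =>
    DFunLike.congr_fun hx φ

theorem KDual.finite_and_evalDual_bijective [FiniteDimensional k Λ] [Module.Finite Λ X] :
    Module.Finite Γ (KDual τ X) ∧ Function.Bijective (evalDual τ X) := by
  let _ : Module k X := Module.compHom X (algebraMap k Λ)
  have : IsScalarTower k Λ X := ⟨fun a b x => by
    rw [Algebra.smul_def, mul_smul]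
    rfl⟩
  let _ : Module k (KDual τ X) := Module.compHom _ (algebraMap k Γ)
  have : IsScalarTower k Γ (KDual τ X) := ⟨fun a b x => by
    rw [Algebra.smul_def, mul_smul]
    rfl⟩
  have : Module.Finite k X := Module.Finite.trans Λ X
  let e : Module.Dual k X ≃ₗ[k] KDual τ X :=
    { toFun := KDual.mk'
      invFun φ :=
        { toFun := φ
          map_add' := map_add φ
          map_smul' := φ.2 }
      left_inv _ := rfl
      right_inv _ := rfl
      map_add' _ _ := rfl
      map_smul' c φ := KDual.ext fun x => (KDual.algebraMap_smul_apply c (KDual.mk' φ) x).symm }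
  have : Module.Finite k (KDual τ X) := Module.Finite.equiv e
  refine ⟨Module.Finite.of_restrictScalars_finite k Γ _, evalDual_injective, fun Φ => ?_⟩
  let Ψ : Module.Dual k (Module.Dual k X) :=
    { toFun φ := Φ (e φ)
      map_add' φ ψ := by rw [map_add, map_add]
      map_smul' c φ := by
        rw [map_smul]
        exact Φ.2 c (e φ) }
  obtain ⟨x, hx⟩ := (Module.bijective_dual_eval k X).2 Ψ
  refine ⟨x, KDual.ext fun φ => ?_⟩
  have := LinearMap.congr_fun hx (e.symm φ)
  exact this.trans (congrArg Φ (e.apply_symm_apply φ))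

end Modules

theorem isNonemptyTorsion_lperp [IsNoetherianRing Λ] (C : Set (ModuleCat.{0} Λ)) :
    IsNonemptyTorsion (lperp Λ C) := by
  refine ⟨⟨fun X hX => hX.1, fun X hX Y f hf => ⟨?_, fun Z hZ g => ?_⟩,
    fun X Y Z f g hfg hX hZ => ⟨?_, fun W hW h => ?_⟩⟩, ModuleCat.of Λ PUnit, ?_, fun Z hZ f => ?_⟩
  · have := hX.1
    exact Module.Finite.of_surjective f hf
  · ext y
    obtain ⟨x, rfl⟩ := hf y
    exact LinearMap.congr_fun (hX.2 Z hZ (g ∘ₗ f)) x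
  · have := hX.1
    have := hZ.1
    have : IsNoetherian Λ Y := isNoetherian_of_range_eq_ker f g hfg.2.2
    infer_instance
  · obtain ⟨h', hh'⟩ := exists_comp_eq_of_ker_le g hfg.2.1 h (by
      rw [← hfg.2.2]
      rintro _ ⟨x, rfl⟩
      exact LinearMap.congr_fun (hX.2 W hW (h ∘ₗ f)) x)
    ext y
    rw [← hh' y, hZ.2 W hW h']
    rfl
  · exact inferInstanceAs (Module.Finite Λ PUnit)
  · ext
    exact map_zero f

/-- The dual torsion class: the modules `Y` with `X ⊗ Y = 0` for all `X` in `C`. -/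
def star (C : Set (ModuleCat.{0} Λ)) : Set (ModuleCat.{0} Γ) :=
  {Y | Module.Finite Γ Y ∧ ∀ X ∈ C, ∀ g : ↥Y →ₗ[Γ] KDual τ X, g = 0}

variable {τ} {C C' T M : Set (ModuleCat.{0} Λ)}

theorem isNonemptyTorsion_star [IsNoetherianRing Γ] : IsNonemptyTorsion (star τ C) := by
  have : star τ C = lperp Γ ((fun X : ModuleCat.{0} Λ => ModuleCat.of Γ (KDual τ X)) '' C) := by
    ext Y
    refine and_congr_right fun _ => ⟨?_, fun h X hX => h _ ⟨X, hX, rfl⟩⟩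
    rintro h _ ⟨X, hX, rfl⟩
    exact h X hX
  rw [this]
  exact isNonemptyTorsion_lperp _

theorem star_anti (h : C ⊆ C') : star τ C' ⊆ star τ C := fun _ hY =>
  ⟨hY.1, fun X hX => hY.2 X (h hX)⟩

theorem subset_star_star (hC : FinMods Λ C) : C ⊆ star (swap τ) (star τ C) := fun X hX =>
  ⟨hC X hX, fun _ hY => forall_eq_zero_iff_transpose.mp (hY.2 X hX)⟩

theorem star_star_subset [FiniteDimensional k Λ] [IsNoetherianRing Λ] (hT : IsNonemptyTorsion T) :
    star (swap τ) (star τ T) ⊆ T := by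
  intro X hX
  have : Module.Finite Λ X := hX.1
  obtain ⟨t, ht, hzero⟩ := hT.exists_torsion_quotient X
  obtain ⟨hfin, hbij⟩ := KDual.finite_and_evalDual_bijective (τ := τ) (X := X ⧸ t)
  have hmem : ModuleCat.of Γ (KDual τ (X ⧸ t)) ∈ star τ T := by
    refine ⟨hfin, fun Z hZ => forall_eq_zero_iff_transpose.mpr fun f => ?_⟩
    let e := LinearEquiv.ofBijective _ hbij
    have h0 := hzero Z hZ (e.symm.toLinearMap ∘ₗ f)
    ext1 z
    exact e.symm.map_eq_zero_iff.mp (LinearMap.congr_fun h0 z)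
  have h0 := hX.2 _ hmem (evalDual τ (X ⧸ t) ∘ₗ t.mkQ)
  have hmk : t.mkQ = 0 := by
    ext1 x
    exact hbij.1 ((LinearMap.congr_fun h0 x).trans (map_zero _).symm)
  have : t = ⊤ := by rw [← t.ker_mkQ, hmk, LinearMap.ker_zero]
  subst this
  exact hT.quot (Y := X) ht (⊤ : Submodule Λ X).subtype fun x => ⟨⟨x, trivial⟩, rfl⟩

end Duality

section Pairing

variable {k Λ Γ : Type} [Field k] [Ring Λ] [Algebra k Λ] [Ring Γ] [Algebra k Γ]
  (σ : Λ ≃ₐ[k] Γᵐᵒᵖ) {l m n : ℕ}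
variable {Y Z : Type} [AddCommGroup Y] [Module Γ Y] [Module k Y] [IsScalarTower k Γ Y]
  [AddCommGroup Z] [Module Γ Z] [Module k Z] [IsScalarTower k Γ Z]

/-- The rows of the matrix over `Γ` corresponding to a map of free `Λ`-modules. -/
def matrixRow (f : (Fin m → Λ) →ₗ[Λ] (Fin n → Λ)) (j : Fin n) : Fin m → Γ :=
  fun i => (σ (f (Pi.single i 1) j)).unop

variable (Y) in
/-- The map `Yᵐ → Yⁿ` obtained by tensoring `f : Λᵐ → Λⁿ` with `Y`. -/
def tensorMap (f : (Fin m → Λ) →ₗ[Λ] (Fin n → Λ)) : (Fin m → Y) →ₗ[k] (Fin n → Y) where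
  toFun y j := Fintype.linearCombination Γ y (matrixRow σ f j)
  map_add' y y' := by
    ext j
    simp [Fintype.linearCombination_apply, Finset.sum_add_distrib]
  map_smul' c y := by
    ext j
    simp [Fintype.linearCombination_apply, Finset.smul_sum, smul_comm c]

theorem tensorMap_apply (f : (Fin m → Λ) →ₗ[Λ] (Fin n → Λ)) (y : Fin m → Y) (j : Fin n) :
    tensorMap σ Y f y j = ∑ i, (σ (f (Pi.single i 1) j)).unop • y i := rfl

theorem tensorMap_naturality (f : (Fin m → Λ) →ₗ[Λ] (Fin n → Λ)) (g : Y →ₗ[Γ] Z)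
    (y : Fin m → Y) : tensorMap σ Z f (fun i => g (y i)) = fun j => g (tensorMap σ Y f y j) := by
  ext j
  simp [tensorMap_apply]

variable {σ}

/-- The pairing of `Hom(Λᵐ, DY)` with `Yᵐ`. -/
def pairing (h : (Fin m → Λ) →ₗ[Λ] KDual σ Y) : (Fin m → Y) →ₗ[k] k where
  toFun y := ∑ i, h (Pi.single i 1) (y i)
  map_add' y y' := by
    simp only [Pi.add_apply, map_add, Finset.sum_add_distrib]
  map_smul' c y := by
    rw [RingHom.id_apply, smul_eq_mul, Finset.mul_sum]
    refine Finset.sum_congr rfl fun i _ => ?_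
    rw [Pi.smul_apply, ← algebraMap_smul Γ c (y i), KDual.map_algebraMap_smul]

theorem pairing_apply (h : (Fin m → Λ) →ₗ[Λ] KDual σ Y) (y : Fin m → Y) :
    pairing h y = ∑ i, h (Pi.single i 1) (y i) := rfl

theorem pairing_zero : pairing (0 : (Fin m → Λ) →ₗ[Λ] KDual σ Y) = 0 :=
  LinearMap.ext fun y => by
    rw [pairing_apply]
    exact Finset.sum_eq_zero fun i _ => KDual.zero_apply (y i)

theorem pairing_single (h : (Fin m → Λ) →ₗ[Λ] KDual σ Y) (i : Fin m) (y : Y) :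
    pairing h (Pi.single i y) = h (Pi.single i 1) y := by
  rw [pairing_apply, Finset.sum_eq_single i, Pi.single_eq_same]
  · intro j _ hj
    rw [Pi.single_eq_of_ne hj, map_zero]
  · intro hi
    exact absurd (Finset.mem_univ i) hi

theorem KDual.sum_apply {W ι : Type} [AddCommGroup W] [Module Γ W] (s : Finset ι)
    (φ : ι → KDual σ W) (w : W) : (∑ i ∈ s, φ i) w = ∑ i ∈ s, φ i w :=
  map_sum (AddMonoidHom.mk' (fun ψ : KDual σ W => ψ w) fun _ _ => rfl) φ s

theorem apply_eq_sum_smul {X : Type} [AddCommGroup X] [Module Λ X] (h : (Fin m → Λ) →ₗ[Λ] X)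
    (v : Fin m → Λ) : h v = ∑ i, v i • h (Pi.single i 1) := by
  conv_lhs => rw [← Finset.univ_sum_single v, map_sum]
  refine Finset.sum_congr rfl fun i _ => ?_
  rw [← map_smul, ← Pi.single_smul, smul_eq_mul, mul_one]

theorem pairing_tensorMap (z : (Fin n → Λ) →ₗ[Λ] KDual σ Y)
    (f : (Fin m → Λ) →ₗ[Λ] (Fin n → Λ)) (y : Fin m → Y) :
    pairing z (tensorMap σ Y f y) = pairing (z ∘ₗ f) y := by
  simp only [pairing_apply, tensorMap_apply, LinearMap.comp_apply, map_sum]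
  rw [Finset.sum_comm]
  refine Finset.sum_congr rfl fun i _ => ?_
  rw [apply_eq_sum_smul z, KDual.sum_apply]
  rfl

theorem hom_ext_single {X : Type} [AddCommGroup X] [Module Λ X] {h h' : (Fin m → Λ) →ₗ[Λ] X}
    (H : ∀ i, h (Pi.single i 1) = h' (Pi.single i 1)) : h = h' :=
  LinearMap.ext fun v => by rw [apply_eq_sum_smul h, apply_eq_sum_smul h']; simp only [H]

theorem exists_hom_single {X : Type} [AddCommGroup X] [Module Λ X] (x : Fin m → X) :
    ∃ h : (Fin m → Λ) →ₗ[Λ] X, ∀ i, h (Pi.single i 1) = x i :=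
  ⟨Fintype.linearCombination Λ x, fun i => by simp⟩

theorem pairing_injective {h h' : (Fin m → Λ) →ₗ[Λ] KDual σ Y} (H : pairing h = pairing h') :
    h = h' :=
  hom_ext_single fun i => KDual.ext fun y => by rw [← pairing_single, H, pairing_single]

theorem exists_pairing (ψ : (Fin m → Y) →ₗ[k] k) :
    ∃ h : (Fin m → Λ) →ₗ[Λ] KDual σ Y, pairing h = ψ := by
  obtain ⟨h, hh⟩ := exists_hom_single (Λ := Λ)
    fun i => KDual.mk' (τ := σ) (ψ ∘ₗ LinearMap.single k (fun _ => Y) i)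
  refine ⟨h, LinearMap.pi_ext fun i y => ?_⟩
  rw [pairing_single, hh]
  rfl

variable (σ) in
theorem eq_of_pairing {y y' : Fin m → Y}
    (H : ∀ h : (Fin m → Λ) →ₗ[Λ] KDual σ Y, pairing h y = pairing h y') : y = y' := by
  refine sub_eq_zero.mp ((Module.forall_dual_apply_eq_zero_iff k _).mp fun ψ => ?_)
  obtain ⟨h, rfl⟩ := exists_pairing (σ := σ) (Λ := Λ) ψ
  rw [map_sub, H, sub_self]

variable (σ) in
theorem tensorMap_comp (g : (Fin m → Λ) →ₗ[Λ] (Fin n → Λ)) (f : (Fin l → Λ) →ₗ[Λ] (Fin m → Λ))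
    (y : Fin l → Y) : tensorMap σ Y g (tensorMap σ Y f y) = tensorMap σ Y (g ∘ₗ f) y :=
  eq_of_pairing σ fun h => by simp only [pairing_tensorMap, LinearMap.comp_assoc]

end Pairing

section Smalo

variable {k Λ Γ : Type} [Field k] [Ring Λ] [Algebra k Λ] [Ring Γ] [Algebra k Γ]
  {σ : Λ ≃ₐ[k] Γᵐᵒᵖ} {m n : ℕ} {T : Set (ModuleCat.{0} Λ)}
  {a : (Fin m → Λ) →ₗ[Λ] (Fin n → Λ)} {ε : (Fin m → Λ) →ₗ[Λ] (Fin m → Λ)}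

/-- The relations saying that a tuple `v` satisfies `a v = 0` and `ε v = v`. -/
def relations (σ : Λ ≃ₐ[k] Γᵐᵒᵖ) (a : (Fin m → Λ) →ₗ[Λ] (Fin n → Λ))
    (ε : (Fin m → Λ) →ₗ[Λ] (Fin m → Λ)) : Submodule Γ (Fin m → Γ) :=
  Submodule.span Γ (Set.range (matrixRow σ a) ∪
    Set.range fun j => matrixRow σ ε j - Pi.single j 1)

variable (σ a ε) in
/-- The module with universal generators `v` satisfying `a v = 0` and `ε v = v`. -/
abbrev UniversalModule : Type := (Fin m → Γ) ⧸ relations σ a ε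

variable (σ a ε) in
/-- The generators of the universal module. -/
def generator (i : Fin m) : UniversalModule σ a ε := (relations σ a ε).mkQ (Pi.single i 1)

theorem linearCombination_generator (w : Fin m → Γ) :
    Fintype.linearCombination Γ (generator σ a ε) w = (relations σ a ε).mkQ w :=
  LinearMap.congr_fun (hom_ext_single (h := Fintype.linearCombination Γ (generator σ a ε))
    (h' := (relations σ a ε).mkQ) fun i => by
      rw [Fintype.linearCombination_apply_single, one_smul]
      rfl) w

theorem tensorMap_generator_eq_zero :
    tensorMap σ (UniversalModule σ a ε) a (generator σ a ε) = 0 := by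
  ext1 j
  refine (linearCombination_generator _).trans ((Submodule.Quotient.mk_eq_zero _).mpr ?_)
  exact Submodule.subset_span (Or.inl ⟨j, rfl⟩)

theorem tensorMap_generator :
    tensorMap σ (UniversalModule σ a ε) ε (generator σ a ε) = generator σ a ε := by
  ext1 j
  refine (linearCombination_generator _).trans ((Submodule.Quotient.eq _).mpr ?_)
  exact Submodule.subset_span (Or.inr ⟨j, rfl⟩)

theorem exists_lift_generator {Y : Type} [AddCommGroup Y] [Module Γ Y] [Module k Y]
    [IsScalarTower k Γ Y] (y : Fin m → Y) (h0 : tensorMap σ Y a y = 0)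
    (h1 : tensorMap σ Y ε y = y) :
    ∃ g : UniversalModule σ a ε →ₗ[Γ] Y, ∀ i, g (generator σ a ε i) = y i := by
  refine ⟨(relations σ a ε).liftQ (Fintype.linearCombination Γ y) (Submodule.span_le.mpr ?_),
    fun i => ?_⟩
  · rintro _ (⟨j, rfl⟩ | ⟨j, rfl⟩)
    · exact congrFun h0 j
    · refine LinearMap.mem_ker.mpr ?_
      rw [map_sub, Fintype.linearCombination_apply_single, one_smul, sub_eq_zero]
      exact congrFun h1 j
  · refine ((relations σ a ε).liftQ_apply _ _).trans ?_
    rw [Fintype.linearCombination_apply_single, one_smul]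

theorem IsPresentation.universalModule_mem [IsNoetherianRing Γ] (h : IsPresentation T a ε) :
    ModuleCat.of Γ (UniversalModule σ a ε) ∈ star (swap σ) T := by
  refine ⟨inferInstanceAs (Module.Finite Γ (UniversalModule σ a ε)), fun X hX => ?_⟩
  change ∀ g : UniversalModule σ a ε →ₗ[Γ] KDual (swap σ) X, g = 0
  intro g
  obtain ⟨t, ht⟩ : ∃ t : X →ₗ[Λ] KDual σ (UniversalModule σ a ε), ∀ x v, t x v = g v x :=
    ⟨transpose g, fun _ _ => rfl⟩
  have key : ∀ (f : (Fin m → Λ) →ₗ[Λ] X), pairing (t ∘ₗ f) (generator σ a ε) = 0 := by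
    intro f
    obtain ⟨z, hz⟩ := h.exists_extend X hX (f ∘ₗ ε) (by rw [LinearMap.comp_assoc, h.idem])
    rw [← tensorMap_generator, pairing_tensorMap, LinearMap.comp_assoc, ← hz,
      ← LinearMap.comp_assoc, ← pairing_tensorMap, tensorMap_generator_eq_zero, map_zero]
  refine Submodule.linearMap_qext _ (hom_ext_single fun i => KDual.ext fun x => ?_)
  obtain ⟨f, hf⟩ := exists_hom_single (Λ := Λ) (Pi.single i x)
  have := key f
  rw [pairing_apply, Finset.sum_eq_single i] at this
  · rw [LinearMap.comp_apply, hf, Pi.single_eq_same, ht] at this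
    exact this
  · intro j _ hj
    rw [LinearMap.comp_apply, hf, Pi.single_eq_of_ne hj, map_zero]
    rfl
  · intro hi
    exact absurd (Finset.mem_univ i) hi

section

variable {Y : Type} [AddCommGroup Y] [Module Γ Y] [Module k Y] [IsScalarTower k Γ Y]

theorem IsPresentation.tensorMap_surjective (h : IsPresentation T a ε)
    (hY : ModuleCat.of Γ Y ∈ star (swap σ) T) : Function.Surjective (tensorMap σ Y a) := by
  refine LinearMap.dualMap_injective_iff.mp ((injective_iff_map_eq_zero _).mpr fun ψ hψ => ?_)
  obtain ⟨z, rfl⟩ := exists_pairing (σ := σ) (Λ := Λ) ψ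
  have hza : z ∘ₗ a = 0 := pairing_injective (LinearMap.ext fun y => by
    rw [← pairing_tensorMap, pairing_zero]
    exact LinearMap.congr_fun hψ y)
  have hz := forall_eq_zero_iff_transpose.mp (hY.2 _ h.coker_mem)
    ((LinearMap.range a).liftQ z (LinearMap.range_le_ker_iff.mpr hza))
  have : z = 0 := by
    rw [← (LinearMap.range a).liftQ_mkQ z (LinearMap.range_le_ker_iff.mpr hza)]
    exact (congrArg (· ∘ₗ (LinearMap.range a).mkQ) hz).trans (LinearMap.zero_comp _)
  rw [this, pairing_zero]

theorem IsPresentation.subsingleton [FiniteDimensional k Γ] (h : IsPresentation T a ε)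
    (hY : ModuleCat.of Γ Y ∈ star (swap σ) T)
    (hzero : ∀ y : Fin m → Y, tensorMap σ Y a y = 0 → tensorMap σ Y ε y = y → y = 0) :
    Subsingleton Y := by
  have : Module.Finite Γ Y := hY.1
  have := (KDual.finite_and_evalDual_bijective (τ := σ) (X := Y)).1
  have hX : ModuleCat.of Λ (KDual σ Y) ∈ T := by
    refine h.mem _ fun f hf => ?_
    have hmem : pairing f ∈ (LinearMap.ker (tensorMap σ Y a)).dualAnnihilator := by
      refine (Submodule.mem_dualAnnihilator _).mpr fun y hy => ?_
      rw [← hf, ← pairing_tensorMap, hzero (tensorMap σ Y ε y), map_zero]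
      · rw [tensorMap_comp, h.comp_eq]
        exact hy
      · rw [tensorMap_comp, h.idem]
    rw [← LinearMap.range_dualMap_eq_dualAnnihilator_ker] at hmem
    obtain ⟨ψ, hψ⟩ := hmem
    obtain ⟨z, rfl⟩ := exists_pairing (σ := σ) (Λ := Λ) ψ
    refine ⟨z, pairing_injective (LinearMap.ext fun y => ?_)⟩
    rw [← pairing_tensorMap, ← hψ]
    rfl
  have h0 := forall_eq_zero_iff_transpose.mp (hY.2 _ hX) LinearMap.id
  exact subsingleton_of_forall_eq 0 fun y => KDual.eq_zero_of_forall σ fun φ =>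
    DFunLike.congr_fun (LinearMap.congr_fun h0 φ) y

theorem IsPresentation.mem_fac [FiniteDimensional k Γ] [IsNoetherianRing Γ]
    (h : IsPresentation T a ε) (hY : ModuleCat.of Γ Y ∈ star (swap σ) T) :
    ModuleCat.of Γ Y ∈ Fac Γ (ModuleCat.of Γ (UniversalModule σ a ε)) := by
  have : Module.Finite Γ Y := hY.1
  have hstar : IsNonemptyTorsion (star (swap σ) T) := isNonemptyTorsion_star
  set N : Submodule Γ Y :=
    ⨆ f ∈ (Set.univ : Set (UniversalModule σ a ε →ₗ[Γ] Y)), LinearMap.range f with hN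
  have hNmem : ModuleCat.of Γ N ∈ star (swap σ) T := hstar.mem_trace h.universalModule_mem _
  have htrace : ∀ y : Fin m → Y, tensorMap σ Y a y = 0 → tensorMap σ Y ε y = y → ∀ i, y i ∈ N := by
    intro y h0 h1 i
    obtain ⟨g, hg⟩ := exists_lift_generator y h0 h1
    rw [← hg]
    exact le_iSup₂_of_le (f := fun f (_ : f ∈ Set.univ) => LinearMap.range f) g trivial le_rfl
      ⟨_, rfl⟩
  have hquot : Subsingleton (Y ⧸ N) := by
    refine h.subsingleton (hstar.quot hY N.mkQ N.mkQ_surjective) fun q h0 h1 => ?_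
    choose y hy using fun i => N.mkQ_surjective (q i)
    obtain rfl : (fun i => N.mkQ (y i)) = q := funext hy
    rw [tensorMap_naturality] at h0 h1
    have h0' : ∀ j, tensorMap σ Y a y j ∈ N := fun j =>
      (Submodule.Quotient.mk_eq_zero N).mp (congrFun h0 j)
    have h1' : ∀ i, tensorMap σ Y ε y i - y i ∈ N := fun i =>
      (Submodule.Quotient.eq N).mp (congrFun h1 i)
    obtain ⟨w, hw⟩ := h.tensorMap_surjective hNmem fun j => ⟨_, h0' j⟩
    have hw' : tensorMap σ Y a (fun i => N.subtype (w i)) = tensorMap σ Y a y := by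
      rw [tensorMap_naturality, hw]
      rfl
    have hu := htrace (tensorMap σ Y ε (y - fun i => N.subtype (w i)))
      (by rw [tensorMap_comp, h.comp_eq, map_sub, hw', sub_self])
      (by rw [tensorMap_comp, h.idem])
    ext1 i
    refine (Submodule.Quotient.mk_eq_zero N).mpr ?_
    have hi := hu i
    rw [map_sub, tensorMap_naturality] at hi
    have := N.sub_mem (N.add_mem hi (tensorMap σ N ε w i).2) (h1' i)
    simpa using this
  refine mem_fac_of_trace (s := Set.univ) ?_
  exact Submodule.Quotient.subsingleton_iff.mp hquot

end

theorem IsPresentation.isFacFinite_star [FiniteDimensional k Γ] [IsNoetherianRing Γ]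
    (h : IsPresentation T a ε) : IsFacFinite Γ (star (swap σ) T) := by
  refine ⟨ModuleCat.of Γ (UniversalModule σ a ε),
    inferInstanceAs (Module.Finite Γ (UniversalModule σ a ε)), Set.Subset.antisymm ?_
      (isNonemptyTorsion_star.fac_subset h.universalModule_mem)⟩
  intro Y hY
  let _ : Module k Y := Module.compHom Y (algebraMap k Γ)
  have : IsScalarTower k Γ Y := ⟨fun b c y => by
    rw [Algebra.smul_def, mul_smul]
    rfl⟩
  exact h.mem_fac (Y := Y) hY

/-- The dual of a functorially finite torsion class is functorially finite. -/
theorem IsNonemptyTorsion.isFTorsionClass_star [FiniteDimensional k Λ] [IsArtinianRing Λ]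
    [FiniteDimensional k Γ] [IsNoetherianRing Γ] (τ : Γ ≃ₐ[k] Λᵐᵒᵖ) (hT : IsNonemptyTorsion T)
    (hfac : IsFacFinite Λ T) : IsFTorsionClass Γ (star τ T) := by
  obtain ⟨m, n, a, ε, h⟩ := hT.exists_isPresentation k hfac
  exact ⟨isNonemptyTorsion_star.isTorsionClass, h.isFacFinite_star (σ := swap τ)⟩

/-- A functorially finite torsion class properly contained in a torsion class `T` is properly
contained in a functorially finite torsion class inside `T`. -/
theorem IsFTorsionClass.exists_isFTorsionClass_gt (k : Type) [Field k] [Algebra k Λ]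
    [FiniteDimensional k Λ] {M : Set (ModuleCat.{0} Λ)}
    (hM : IsFTorsionClass Λ M) (hT : IsNonemptyTorsion T) (hMT : M ⊆ T) (hne : M ≠ T) :
    ∃ G, IsFTorsionClass Λ G ∧ M ⊆ G ∧ G ⊆ T ∧ G ≠ M := by
  have hM' := hM.isNonemptyTorsion
  have : IsArtinianRing Λ := IsArtinianRing.of_finite k Λ
  have : FiniteDimensional k Λᵐᵒᵖ := Module.Finite.equiv (MulOpposite.opLinearEquiv k)
  have : IsArtinianRing Λᵐᵒᵖ := IsArtinianRing.of_finite k Λᵐᵒᵖ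
  let τ : Λᵐᵒᵖ ≃ₐ[k] Λᵐᵒᵖ := AlgEquiv.refl
  have hstar := hM'.isFTorsionClass_star τ hM.2
  have hneStar : star τ T ≠ star τ M := fun heq => hne (hMT.antisymm ((subset_star_star
    (τ := τ) hT.isTorsionClass.1).trans (heq ▸ star_star_subset hM')))
  obtain ⟨G, hG, hTG, hGM, hGne⟩ := hstar.isNonemptyTorsion.exists_isFTorsionClass_lt k hstar.2
    isNonemptyTorsion_star (star_anti hMT) hneStar
  refine ⟨star (swap τ) G, hG.isNonemptyTorsion.isFTorsionClass_star (swap τ) hG.2,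
    (subset_star_star (τ := τ) hM.1.1).trans (star_anti hGM),
    (star_anti hTG).trans (star_star_subset hT), fun heq => hGne (hGM.antisymm ?_)⟩
  rw [← heq]
  exact star_star_subset (τ := swap τ) hG.isNonemptyTorsion

end Smalo

section Final

variable {Λ : Type} [Ring Λ]

theorem isNonemptyTorsion_interMod {𝒮 : Set (Set (ModuleCat.{0} Λ))}
    (h : ∀ C ∈ 𝒮, IsNonemptyTorsion C) [IsNoetherianRing Λ] :
    IsNonemptyTorsion (interMod Λ 𝒮) := by
  have hl := isNonemptyTorsion_lperp (∅ : Set (ModuleCat.{0} Λ))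
  refine ⟨⟨fun X hX => hX.1, fun X hX Y f hf => ⟨?_, fun C hC => ?_⟩,
    fun X Y Z f g hfg hX hZ => ⟨?_, fun C hC => ?_⟩⟩, ModuleCat.of Λ PUnit,
    inferInstanceAs (Module.Finite Λ PUnit), fun C hC => (h C hC).of_subsingleton⟩
  · have := hX.1
    exact Module.Finite.of_surjective f hf
  · exact (h C hC).isTorsionClass.2.1 X (hX.2 C hC) Y f hf
  · exact (hl.isTorsionClass.2.2 X Y Z f g hfg ⟨hX.1, fun _ h => h.elim⟩
      ⟨hZ.1, fun _ h => h.elim⟩).1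
  · exact (h C hC).isTorsionClass.2.2 X Y Z f g hfg (hX.2 C hC) (hZ.2 C hC)

theorem hasMeet_iff (k : Type) [Field k] [Algebra k Λ] [FiniteDimensional k Λ]
    (S : Set (FTors Λ)) : HasMeet S ↔ IsFacFinite Λ (interMod Λ (Subtype.val '' S)) := by
  have : IsArtinianRing Λ := IsArtinianRing.of_finite k Λ
  have hI : IsNonemptyTorsion (interMod Λ (Subtype.val '' S)) :=
    isNonemptyTorsion_interMod fun C ⟨T, _, hT⟩ => hT ▸ T.2.isNonemptyTorsion
  have hlower (T : FTors Λ) : T ∈ lowerBounds S ↔ T.1 ⊆ interMod Λ (Subtype.val '' S) := by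
    refine ⟨fun h X hX => ⟨T.2.1.1 X hX, ?_⟩, fun h U hU X hX => (h hX).2 U ⟨U, hU, rfl⟩⟩
    rintro _ ⟨U, hU, rfl⟩
    exact h hU hX
  constructor
  · rintro ⟨m, ⟨hm, hmax⟩, -⟩
    by_cases hne : m.1 = interMod Λ (Subtype.val '' S)
    · exact hne ▸ m.2.2
    · obtain ⟨G, hG, hmG, hGI, hGne⟩ :=
        m.2.exists_isFTorsionClass_gt k hI ((hlower m).mp hm) hne
      exact absurd (congrArg Subtype.val (hmax ⟨G, hG⟩ ((hlower _).mpr hGI) hmG)) hGne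
  · intro hfac
    refine ⟨⟨_, hI.isTorsionClass, hfac⟩, ⟨(hlower _).mpr subset_rfl, fun y hy hle =>
      le_antisymm ((hlower y).mp hy) hle⟩, fun y hy => ?_⟩
    exact (hy.2 _ ((hlower _).mpr subset_rfl) ((hlower y).mp hy.1)).symm

theorem hasJoin_iff (k : Type) [Field k] [Algebra k Λ] [FiniteDimensional k Λ]
    (S : Set (FTors Λ)) : HasJoin S ↔
      IsFacFinite Λ (lperp Λ (interMod Λ ((fun T : FTors Λ => rperp Λ T.val) '' S))) := by
  have : IsArtinianRing Λ := IsArtinianRing.of_finite k Λ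
  set J := lperp Λ (interMod Λ ((fun T : FTors Λ => rperp Λ T.val) '' S)) with hJdef
  have hJ : IsNonemptyTorsion J := isNonemptyTorsion_lperp _
  have hupper (T : FTors Λ) : T ∈ upperBounds S ↔ J ⊆ T.1 := by
    refine ⟨fun h X hX => ?_, fun h U hU X hX => h ⟨U.2.1.1 X hX, fun Y hY =>
      (hY.2 _ ⟨U, hU, rfl⟩).2 X hX⟩⟩
    have : Module.Finite Λ X := hX.1
    refine T.2.isNonemptyTorsion.mem_of_lperp_rperp (X := X) ⟨hX.1, fun Y hY => hX.2 Y ⟨hY.1, ?_⟩⟩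
    rintro _ ⟨U, hU, rfl⟩
    exact ⟨hY.1, fun Z hZ => hY.2 Z (h hU hZ)⟩
  constructor
  · rintro ⟨m, ⟨hm, hmin⟩, -⟩
    by_cases hne : J = m.1
    · exact hne ▸ m.2.2
    · obtain ⟨G, hG, hJG, hGm, hGne⟩ :=
        m.2.isNonemptyTorsion.exists_isFTorsionClass_lt k m.2.2 hJ ((hupper m).mp hm) hne
      exact absurd (congrArg Subtype.val (hmin ⟨G, hG⟩ ((hupper _).mpr hJG) hGm)) hGne
  · intro hfac
    refine ⟨⟨J, hJ.isTorsionClass, hfac⟩, ⟨(hupper _).mpr subset_rfl, fun y hy hle =>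
      le_antisymm hle ((hupper y).mp hy)⟩, fun y hy => ?_⟩
    exact (hy.2 _ ((hupper _).mpr subset_rfl) ((hupper y).mp hy.1)).symm

end Final

/-- **Theorem 1.14.** A subset `{Tᵢ}` of `ftors Λ` has a meet in `ftors Λ` if and only if
`⋂ᵢ Tᵢ` is functorially finite, and it has a join in `ftors Λ` if and only if
`^⊥(⋂ᵢ Tᵢ^⊥)` is functorially finite. -/
theorem meet_join_criterion (k Λ : Type) [Field k] [IsAlgClosed k]
    [Ring Λ] [Algebra k Λ] [FiniteDimensional k Λ] :
    (∀ S : Set (FTors Λ),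
      HasMeet S ↔ IsFacFinite Λ (interMod Λ (Subtype.val '' S))) ∧
    (∀ S : Set (FTors Λ),
      HasJoin S ↔
        IsFacFinite Λ (lperp Λ (interMod Λ ((fun T : FTors Λ => rperp Λ T.val) '' S)))) := by
  exact ⟨hasMeet_iff k, hasJoin_iff k⟩
end TorsionLattice
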